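/- Let 0<α<1 and 0<β<∞, let u be holomorphic on 𝔻 and φ a holomorphic self-map of 𝔻, and suppose uC_φ maps B^α boundedly into Z_β. Then there exist constants c, C > 0 depending only on α and β (not on u and φ) such that c·M ≤ ‖uC_φ‖_e ≤ C·M, where ‖uC_φ‖_e is the essential norm of uC_φ : B^α → Z_β and M = max{ limsup_{n→∞} (n+1)^α ‖(2u'φ' + uφ'')·φ^n‖_{ν_β}, limsup_{n→∞} (n+1)^{α+1} ‖u·(φ')²·φ^n‖_{ν_β} }. -/

import Mathlib

open Complex Filter Set

noncomputable section

/-- The open unit disk in `ℂ`. -/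
def unitDisk : Set ℂ := Metric.ball 0 1

/-- The weighted sup-norm `‖g‖_{ν_γ} = sup_{z ∈ 𝔻} (1-|z|²)^γ |g(z)|`. -/
def wnorm (γ : ℝ) (g : ℂ → ℂ) : ℝ :=
  sSup ((fun z => (1 - ‖z‖ ^ 2) ^ γ * ‖g z‖) '' unitDisk)

/-- Membership in the weighted Banach space `H^∞_{ν_β}`. -/
def MemWeighted (β : ℝ) (g : ℂ → ℂ) : Prop :=
  DifferentiableOn ℂ g unitDisk ∧
    BddAbove ((fun z => (1 - ‖z‖ ^ 2) ^ β * ‖g z‖) '' unitDisk)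

/-- Membership in the Bloch type space `B^α`. -/
def MemBloch (α : ℝ) (f : ℂ → ℂ) : Prop :=
  DifferentiableOn ℂ f unitDisk ∧
    BddAbove ((fun z => (1 - ‖z‖ ^ 2) ^ α * ‖deriv f z‖) '' unitDisk)

/-- The Bloch type norm `‖f‖_{B^α} = |f(0)| + sup_{z∈𝔻}(1-|z|²)^α |f'(z)|`. -/
def blochNorm (α : ℝ) (f : ℂ → ℂ) : ℝ :=
  ‖f 0‖ + wnorm α (deriv f)

/-- Membership in the Zygmund type space `Z_β`. -/
def MemZygmund (β : ℝ) (f : ℂ → ℂ) : Prop :=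
  DifferentiableOn ℂ f unitDisk ∧
    BddAbove ((fun z => (1 - ‖z‖ ^ 2) ^ β * ‖deriv (deriv f) z‖) '' unitDisk)

/-- The Zygmund type norm `‖f‖_{Z_β} = |f(0)| + |f'(0)| + sup_{z∈𝔻}(1-|z|²)^β |f''(z)|`. -/
def zygNorm (β : ℝ) (f : ℂ → ℂ) : ℝ :=
  ‖f 0‖ + ‖deriv f 0‖ + wnorm β (deriv (deriv f))

/-- The weighted composition operator `uC_φ f = u · (f ∘ φ)`. -/
def wcomp (u φ f : ℂ → ℂ) : ℂ → ℂ := fun z => u z * f (φ z)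

/-- `uC_φ` maps `B^α` boundedly into `Z_β`. -/
def BoundedBlochToZygmund (α β : ℝ) (u φ : ℂ → ℂ) : Prop :=
  (∀ f, MemBloch α f → MemZygmund β (wcomp u φ f)) ∧
    ∃ C > 0, ∀ f, MemBloch α f → zygNorm β (wcomp u φ f) ≤ C * blochNorm α f

/-- `uC_φ` maps `B^α` boundedly into `H^∞_{ν_β}`. -/
def BoundedBlochToWeighted (α β : ℝ) (u φ : ℂ → ℂ) : Prop :=
  (∀ f, MemBloch α f → MemWeighted β (wcomp u φ f)) ∧
    ∃ C > 0, ∀ f, MemBloch α f → wnorm β (wcomp u φ f) ≤ C * blochNorm α f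

/-- `uC_φ : B^α → Z_β` is compact: it is bounded and maps bounded sets of `B^α` to
totally bounded (equivalently, since `Z_β` is complete, relatively compact) subsets
of `Z_β`. -/
def CompactBlochToZygmund (α β : ℝ) (u φ : ℂ → ℂ) : Prop :=
  BoundedBlochToZygmund α β u φ ∧
    ∀ r : ℝ, ∀ ε : ℝ, 0 < ε → ∃ T : Finset (ℂ → ℂ),
      (∀ g ∈ T, MemZygmund β g) ∧
      ∀ f, MemBloch α f → blochNorm α f ≤ r →
        ∃ g ∈ T, zygNorm β (fun z => wcomp u φ f z - g z) ≤ ε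

/-- `uC_φ : B^α → H^∞_{ν_β}` is compact: it is bounded and maps bounded sets of `B^α`
to totally bounded (equivalently, relatively compact) subsets of `H^∞_{ν_β}`. -/
def CompactBlochToWeighted (α β : ℝ) (u φ : ℂ → ℂ) : Prop :=
  BoundedBlochToWeighted α β u φ ∧
    ∀ r : ℝ, ∀ ε : ℝ, 0 < ε → ∃ T : Finset (ℂ → ℂ),
      (∀ g ∈ T, MemWeighted β g) ∧
      ∀ f, MemBloch α f → blochNorm α f ≤ r →
        ∃ g ∈ T, wnorm β (fun z => wcomp u φ f z - g z) ≤ ε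

/-- A compact (linear, bounded, with totally bounded image of the unit ball) operator
from the subspace of `B^α` cut out by the predicate `P` into `Z_β`. -/
def IsCompactOpToZygmund (α β : ℝ) (P : (ℂ → ℂ) → Prop) (K : (ℂ → ℂ) → ℂ → ℂ) : Prop :=
  (∀ f g, P f → P g → ∀ a b : ℂ,
      K (fun z => a * f z + b * g z) = fun z => a * K f z + b * K g z) ∧
  (∀ f, P f → MemZygmund β (K f)) ∧
  (∃ C, ∀ f, P f → zygNorm β (K f) ≤ C * blochNorm α f) ∧
  (∀ ε : ℝ, 0 < ε → ∃ T : Finset (ℂ → ℂ), (∀ g ∈ T, MemZygmund β g) ∧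
      ∀ f, P f → blochNorm α f ≤ 1 → ∃ g ∈ T, zygNorm β (fun z => K f z - g z) ≤ ε)

/-- The essential norm of `uC_φ`, as an operator from the subspace of `B^α` cut out by
the predicate `P` into `Z_β`: the distance to the compact operators, the operator norm
being the supremum over the unit ball. -/
def essNormZ (α β : ℝ) (P : (ℂ → ℂ) → Prop) (u φ : ℂ → ℂ) : ℝ :=
  sInf {r | ∃ K, IsCompactOpToZygmund α β P K ∧
    r = sSup {s | ∃ f, P f ∧ blochNorm α f ≤ 1 ∧
          s = zygNorm β (fun z => wcomp u φ f z - K f z)}}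

/-- A compact (linear, bounded, with totally bounded image of the unit ball) operator
from `B^α` into `H^∞_{ν_β}`. -/
def IsCompactOpToWeighted (α β : ℝ) (K : (ℂ → ℂ) → ℂ → ℂ) : Prop :=
  (∀ f g, MemBloch α f → MemBloch α g → ∀ a b : ℂ,
      K (fun z => a * f z + b * g z) = fun z => a * K f z + b * K g z) ∧
  (∀ f, MemBloch α f → MemWeighted β (K f)) ∧
  (∃ C, ∀ f, MemBloch α f → wnorm β (K f) ≤ C * blochNorm α f) ∧
  (∀ ε : ℝ, 0 < ε → ∃ T : Finset (ℂ → ℂ), (∀ g ∈ T, MemWeighted β g) ∧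
      ∀ f, MemBloch α f → blochNorm α f ≤ 1 → ∃ g ∈ T, wnorm β (fun z => K f z - g z) ≤ ε)

/-- The essential norm of `uC_φ : B^α → H^∞_{ν_β}`. -/
def essNormW (α β : ℝ) (u φ : ℂ → ℂ) : ℝ :=
  sInf {r | ∃ K, IsCompactOpToWeighted α β K ∧
    r = sSup {s | ∃ f, MemBloch α f ∧ blochNorm α f ≤ 1 ∧
          s = wnorm β (fun z => wcomp u φ f z - K f z)}}

/-- `limsup_{|φ(z)|→1} F(z) = lim_{s→1⁻} sup {F z : z ∈ 𝔻, |φ z| > s}`.  Since the inner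
supremum is nonincreasing in `s`, the limit equals the infimum over `s ∈ [0,1)`; note
that `Real.sSup ∅ = 0`, matching the convention that the value is `0` when
`{z : |φ z| > s}` is empty for some `s < 1`. -/
def phiLimsup (φ : ℂ → ℂ) (F : ℂ → ℝ) : ℝ :=
  sInf ((fun s => sSup {y | ∃ z ∈ unitDisk, s < ‖φ z‖ ∧ y = F z}) '' Set.Ico (0:ℝ) 1)

theorem isOpen_unitDisk : IsOpen unitDisk := Metric.isOpen_ball

theorem mem_unitDisk {z : ℂ} : z ∈ unitDisk ↔ ‖z‖ < 1 := by
  simp [unitDisk]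

theorem unitDisk_mem_nhds {z : ℂ} (hz : z ∈ unitDisk) : unitDisk ∈ nhds z :=
  isOpen_unitDisk.mem_nhds hz

theorem zero_mem_unitDisk : (0 : ℂ) ∈ unitDisk := by
  simp [mem_unitDisk]

theorem one_sub_norm_sq_pos {z : ℂ} (hz : z ∈ unitDisk) : 0 < 1 - ‖z‖ ^ 2 := by
  rw [mem_unitDisk] at hz
  nlinarith [norm_nonneg z]

theorem weight_pos (γ : ℝ) {z : ℂ} (hz : z ∈ unitDisk) : 0 < (1 - ‖z‖ ^ 2) ^ γ :=
  Real.rpow_pos_of_pos (one_sub_norm_sq_pos hz) _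

theorem weight_le_one {γ : ℝ} (hγ : 0 ≤ γ) {z : ℂ} (hz : z ∈ unitDisk) :
    (1 - ‖z‖ ^ 2) ^ γ ≤ 1 :=
  Real.rpow_le_one (one_sub_norm_sq_pos hz).le (by nlinarith [norm_nonneg z]) hγ

theorem le_wnorm {γ : ℝ} {g : ℂ → ℂ}
    (h : BddAbove ((fun z => (1 - ‖z‖ ^ 2) ^ γ * ‖g z‖) '' unitDisk)) {z : ℂ}
    (hz : z ∈ unitDisk) : (1 - ‖z‖ ^ 2) ^ γ * ‖g z‖ ≤ wnorm γ g :=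
  le_csSup h ⟨z, hz, rfl⟩

theorem wnorm_le {γ c : ℝ} {g : ℂ → ℂ} (hc : 0 ≤ c)
    (h : ∀ z ∈ unitDisk, (1 - ‖z‖ ^ 2) ^ γ * ‖g z‖ ≤ c) : wnorm γ g ≤ c := by
  refine Real.sSup_le ?_ hc
  rintro _ ⟨z, hz, rfl⟩
  exact h z hz

theorem wnorm_nonneg (γ : ℝ) (g : ℂ → ℂ) : 0 ≤ wnorm γ g := by
  refine Real.sSup_nonneg ?_
  rintro _ ⟨z, hz, rfl⟩
  exact mul_nonneg (weight_pos γ hz).le (norm_nonneg _)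

theorem zygNorm_nonneg (β : ℝ) (f : ℂ → ℂ) : 0 ≤ zygNorm β f := by
  have := wnorm_nonneg β (deriv (deriv f))
  unfold zygNorm
  positivity

theorem blochNorm_nonneg (α : ℝ) (f : ℂ → ℂ) : 0 ≤ blochNorm α f := by
  have := wnorm_nonneg α (deriv f)
  unfold blochNorm
  positivity

theorem bddAbove_weighted {γ c : ℝ} {g : ℂ → ℂ}
    (h : ∀ z ∈ unitDisk, (1 - ‖z‖ ^ 2) ^ γ * ‖g z‖ ≤ c) :
    BddAbove ((fun z => (1 - ‖z‖ ^ 2) ^ γ * ‖g z‖) '' unitDisk) :=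
  ⟨c, by rintro _ ⟨z, hz, rfl⟩; exact h z hz⟩

theorem differentiableAt_of_mem {f : ℂ → ℂ} (hf : DifferentiableOn ℂ f unitDisk) {z : ℂ}
    (hz : z ∈ unitDisk) : DifferentiableAt ℂ f z :=
  hf.differentiableAt (unitDisk_mem_nhds hz)

theorem differentiableOn_deriv {f : ℂ → ℂ} (hf : DifferentiableOn ℂ f unitDisk) :
    DifferentiableOn ℂ (deriv f) unitDisk :=
  hf.deriv isOpen_unitDisk

theorem deriv_lincomb {f g : ℂ → ℂ} (hf : DifferentiableOn ℂ f unitDisk)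
    (hg : DifferentiableOn ℂ g unitDisk) (a b : ℂ) {z : ℂ} (hz : z ∈ unitDisk) :
    deriv (fun z => a * f z + b * g z) z = a * deriv f z + b * deriv g z :=
  (((differentiableAt_of_mem hf hz).hasDerivAt.const_mul a).add
    ((differentiableAt_of_mem hg hz).hasDerivAt.const_mul b)).deriv

theorem deriv_deriv_lincomb {f g : ℂ → ℂ} (hf : DifferentiableOn ℂ f unitDisk)
    (hg : DifferentiableOn ℂ g unitDisk) (a b : ℂ) {z : ℂ} (hz : z ∈ unitDisk) :
    deriv (deriv (fun z => a * f z + b * g z)) z =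
      a * deriv (deriv f) z + b * deriv (deriv g) z := by
  have h : deriv (fun z => a * f z + b * g z) =ᶠ[nhds z]
      fun z => a * deriv f z + b * deriv g z := by
    filter_upwards [unitDisk_mem_nhds hz] with w hw
    exact deriv_lincomb hf hg a b hw
  rw [h.deriv_eq, deriv_lincomb (differentiableOn_deriv hf) (differentiableOn_deriv hg) a b hz]

theorem weighted_lincomb_le {γ : ℝ} {f g : ℂ → ℂ}
    (hf : BddAbove ((fun z => (1 - ‖z‖ ^ 2) ^ γ * ‖f z‖) '' unitDisk))
    (hg : BddAbove ((fun z => (1 - ‖z‖ ^ 2) ^ γ * ‖g z‖) '' unitDisk)) (a b : ℂ) {z : ℂ}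
    (hz : z ∈ unitDisk) :
    (1 - ‖z‖ ^ 2) ^ γ * ‖a * f z + b * g z‖ ≤ ‖a‖ * wnorm γ f + ‖b‖ * wnorm γ g := by
  calc (1 - ‖z‖ ^ 2) ^ γ * ‖a * f z + b * g z‖
      ≤ (1 - ‖z‖ ^ 2) ^ γ * (‖a‖ * ‖f z‖ + ‖b‖ * ‖g z‖) := by
        gcongr
        · exact (weight_pos γ hz).le
        · exact (norm_add_le _ _).trans (by rw [norm_mul, norm_mul])
    _ = ‖a‖ * ((1 - ‖z‖ ^ 2) ^ γ * ‖f z‖) + ‖b‖ * ((1 - ‖z‖ ^ 2) ^ γ * ‖g z‖) := by ring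
    _ ≤ _ := by
        gcongr
        · exact le_wnorm hf hz
        · exact le_wnorm hg hz

theorem MemZygmund.lincomb {β : ℝ} {f g : ℂ → ℂ} (hf : MemZygmund β f) (hg : MemZygmund β g)
    (a b : ℂ) : MemZygmund β (fun z => a * f z + b * g z) :=
  ⟨(hf.1.const_mul a).add (hg.1.const_mul b), bddAbove_weighted fun z hz => by
    rw [deriv_deriv_lincomb hf.1 hg.1 a b hz]
    exact weighted_lincomb_le hf.2 hg.2 a b hz⟩

theorem zygNorm_lincomb_le {β : ℝ} {f g : ℂ → ℂ} (hf : MemZygmund β f) (hg : MemZygmund β g)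
    (a b : ℂ) :
    zygNorm β (fun z => a * f z + b * g z) ≤ ‖a‖ * zygNorm β f + ‖b‖ * zygNorm β g := by
  have h0 : ‖a * f 0 + b * g 0‖ ≤ ‖a‖ * ‖f 0‖ + ‖b‖ * ‖g 0‖ :=
    (norm_add_le _ _).trans (by rw [norm_mul, norm_mul])
  have h1 : ‖deriv (fun z => a * f z + b * g z) 0‖ ≤ ‖a‖ * ‖deriv f 0‖ + ‖b‖ * ‖deriv g 0‖ := by
    rw [deriv_lincomb hf.1 hg.1 a b zero_mem_unitDisk]
    exact (norm_add_le _ _).trans (by rw [norm_mul, norm_mul])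
  have h2 : wnorm β (deriv (deriv (fun z => a * f z + b * g z))) ≤
      ‖a‖ * wnorm β (deriv (deriv f)) + ‖b‖ * wnorm β (deriv (deriv g)) := by
    refine wnorm_le ?_ fun z hz => ?_
    · have := wnorm_nonneg β (deriv (deriv f))
      have := wnorm_nonneg β (deriv (deriv g))
      positivity
    · rw [deriv_deriv_lincomb hf.1 hg.1 a b hz]
      exact weighted_lincomb_le hf.2 hg.2 a b hz
  unfold zygNorm
  linarith

theorem MemBloch.lincomb {α : ℝ} {f g : ℂ → ℂ} (hf : MemBloch α f) (hg : MemBloch α g)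
    (a b : ℂ) : MemBloch α (fun z => a * f z + b * g z) :=
  ⟨(hf.1.const_mul a).add (hg.1.const_mul b), bddAbove_weighted fun z hz => by
    rw [deriv_lincomb hf.1 hg.1 a b hz]
    exact weighted_lincomb_le hf.2 hg.2 a b hz⟩

theorem MemZygmund.sub {β : ℝ} {f g : ℂ → ℂ} (hf : MemZygmund β f) (hg : MemZygmund β g) :
    MemZygmund β (fun z => f z - g z) := by
  simpa [sub_eq_add_neg] using hf.lincomb hg 1 (-1)

theorem zygNorm_sub_le {β : ℝ} {f g : ℂ → ℂ} (hf : MemZygmund β f) (hg : MemZygmund β g) :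
    zygNorm β (fun z => f z - g z) ≤ zygNorm β f + zygNorm β g := by
  simpa [sub_eq_add_neg] using zygNorm_lincomb_le hf hg 1 (-1)

theorem zygNorm_le_add_sub {β : ℝ} {f g : ℂ → ℂ} (hf : MemZygmund β f) (hg : MemZygmund β g) :
    zygNorm β f ≤ zygNorm β g + zygNorm β (fun z => f z - g z) := by
  simpa using zygNorm_lincomb_le hg (hf.sub hg) 1 1

theorem MemBloch.sub {α : ℝ} {f g : ℂ → ℂ} (hf : MemBloch α f) (hg : MemBloch α g) :
    MemBloch α (fun z => f z - g z) := by
  simpa [sub_eq_add_neg] using hf.lincomb hg 1 (-1)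

theorem deriv_wcomp {u φ h : ℂ → ℂ} (hu : DifferentiableOn ℂ u unitDisk)
    (hφ : DifferentiableOn ℂ φ unitDisk) (hm : MapsTo φ unitDisk unitDisk)
    (hh : DifferentiableOn ℂ h unitDisk) {z : ℂ} (hz : z ∈ unitDisk) :
    deriv (wcomp u φ h) z = deriv u z * h (φ z) + u z * (deriv h (φ z) * deriv φ z) :=
  ((differentiableAt_of_mem hu hz).hasDerivAt.mul
    ((differentiableAt_of_mem hh (hm hz)).hasDerivAt.comp z
      (differentiableAt_of_mem hφ hz).hasDerivAt)).deriv

theorem deriv_deriv_wcomp {u φ h : ℂ → ℂ} (hu : DifferentiableOn ℂ u unitDisk)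
    (hφ : DifferentiableOn ℂ φ unitDisk) (hm : MapsTo φ unitDisk unitDisk)
    (hh : DifferentiableOn ℂ h unitDisk) {z : ℂ} (hz : z ∈ unitDisk) :
    deriv (deriv (wcomp u φ h)) z = deriv (deriv u) z * h (φ z) +
      (2 * deriv u z * deriv φ z + u z * deriv (deriv φ) z) * deriv h (φ z) +
      u z * deriv φ z ^ 2 * deriv (deriv h) (φ z) := by
  have e : deriv (wcomp u φ h) =ᶠ[nhds z]
      fun z => deriv u z * h (φ z) + u z * (deriv h (φ z) * deriv φ z) := by
    filter_upwards [unitDisk_mem_nhds hz] with w hw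
    exact deriv_wcomp hu hφ hm hh hw
  have du := (differentiableAt_of_mem hu hz).hasDerivAt
  have du' := (differentiableAt_of_mem (differentiableOn_deriv hu) hz).hasDerivAt
  have dφ := (differentiableAt_of_mem hφ hz).hasDerivAt
  have dφ' := (differentiableAt_of_mem (differentiableOn_deriv hφ) hz).hasDerivAt
  have dh := (differentiableAt_of_mem hh (hm hz)).hasDerivAt
  have dh' := (differentiableAt_of_mem (differentiableOn_deriv hh) (hm hz)).hasDerivAt
  have := (du'.mul (dh.comp z dφ)).add (du.mul ((dh'.comp z dφ).mul dφ'))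
  rw [e.deriv_eq]
  refine this.deriv.trans ?_
  simp only [Function.comp, Pi.mul_apply]
  ring

theorem one_sub_mul_succ_mul_pow_le {x : ℝ} (h0 : 0 ≤ x) (h1 : x ≤ 1) (n : ℕ) :
    (1 - x) * (((n : ℝ) + 1) * x ^ n) ≤ 1 := by
  have hs : ((n : ℝ) + 1) * x ^ n ≤ ∑ i ∈ Finset.range (n + 1), x ^ i := by
    have := Finset.card_nsmul_le_sum (Finset.range (n + 1)) (fun i => x ^ i) (x ^ n) fun i hi =>
      pow_le_pow_of_le_one h0 h1 (Nat.lt_succ_iff.mp (Finset.mem_range.mp hi))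
    simpa using this
  calc (1 - x) * (((n : ℝ) + 1) * x ^ n)
      ≤ (1 - x) * ∑ i ∈ Finset.range (n + 1), x ^ i := by
        gcongr
    _ = 1 - x ^ (n + 1) := mul_neg_geom_sum x (n + 1)
    _ ≤ 1 := by linarith [pow_nonneg h0 (n + 1)]

theorem weight_mul_rpow_mul_pow_le {α : ℝ} (hα0 : 0 < α) (hα1 : α < 1) {x : ℝ} (h0 : 0 ≤ x)
    (h1 : x < 1) (n : ℕ) : (1 - x ^ 2) ^ α * (((n : ℝ) + 1) ^ α * x ^ n) ≤ 2 := by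
  have hx : x ^ n ≤ (x ^ n) ^ α :=
    Real.self_le_rpow_of_le_one (pow_nonneg h0 n) (pow_le_one₀ h0 h1.le) hα1.le
  have hd : 0 ≤ 1 - x ^ 2 := by nlinarith
  have hn : (0 : ℝ) ≤ (n : ℝ) + 1 := by positivity
  calc (1 - x ^ 2) ^ α * (((n : ℝ) + 1) ^ α * x ^ n)
      ≤ (1 - x ^ 2) ^ α * (((n : ℝ) + 1) ^ α * (x ^ n) ^ α) := by gcongr
    _ = ((1 - x ^ 2) * (((n : ℝ) + 1) * x ^ n)) ^ α := by
        rw [Real.mul_rpow hd (by positivity), Real.mul_rpow hn (by positivity)]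
    _ ≤ 2 ^ α := by
        refine Real.rpow_le_rpow (by positivity) ?_ hα0.le
        have := one_sub_mul_succ_mul_pow_le h0 h1.le n
        have h3 : 0 ≤ (1 - x) * (((n : ℝ) + 1) * x ^ n) :=
          mul_nonneg (by linarith) (by positivity)
        nlinarith
    _ ≤ 2 ^ (1 : ℝ) := Real.rpow_le_rpow_of_exponent_le (by norm_num) hα1.le
    _ = 2 := by norm_num

/-- The monomial `z ^ (n + 1)`, scaled so as to lie in the unit ball of `B^α`. -/
def scaledMonomial (α : ℝ) (n : ℕ) : ℂ → ℂ :=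
  fun z => ((((n : ℝ) + 1) ^ (α - 1) / 2 : ℝ) : ℂ) * z ^ (n + 1)

theorem deriv_scaledMonomial (α : ℝ) (n : ℕ) :
    deriv (scaledMonomial α n) = fun z => ((((n : ℝ) + 1) ^ α / 2 : ℝ) : ℂ) * z ^ n := by
  funext z
  have h := (hasDerivAt_pow (n + 1) z).const_mul ((((n : ℝ) + 1) ^ (α - 1) / 2 : ℝ) : ℂ)
  refine h.deriv.trans ?_
  have e : ((n : ℝ) + 1) ^ α = ((n : ℝ) + 1) ^ (α - 1) * ((n : ℝ) + 1) := by
    rw [← Real.rpow_add_one (by positivity)]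
    congr 1
    ring
  rw [e]
  push_cast
  ring

theorem deriv_deriv_scaledMonomial (α : ℝ) (n : ℕ) :
    deriv (deriv (scaledMonomial α n)) =
      fun z => ((((n : ℝ) + 1) ^ α / 2 : ℝ) : ℂ) * (n * z ^ (n - 1)) := by
  rw [deriv_scaledMonomial]
  funext z
  exact ((hasDerivAt_pow n z).const_mul _).deriv

theorem norm_deriv_scaledMonomial (α : ℝ) (n : ℕ) (z : ℂ) :
    ‖deriv (scaledMonomial α n) z‖ = ((n : ℝ) + 1) ^ α / 2 * ‖z‖ ^ n := by
  rw [deriv_scaledMonomial]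
  simp only [norm_mul, norm_pow, Complex.norm_real, Real.norm_eq_abs]
  rw [abs_of_nonneg (by positivity)]

theorem weight_mul_deriv_scaledMonomial_le {α : ℝ} (hα0 : 0 < α) (hα1 : α < 1) (n : ℕ) {z : ℂ}
    (hz : z ∈ unitDisk) : (1 - ‖z‖ ^ 2) ^ α * ‖deriv (scaledMonomial α n) z‖ ≤ 1 := by
  have := weight_mul_rpow_mul_pow_le hα0 hα1 (norm_nonneg z) (mem_unitDisk.mp hz) n
  rw [norm_deriv_scaledMonomial]
  linarith

theorem differentiable_scaledMonomial (α : ℝ) (n : ℕ) :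
    Differentiable ℂ (scaledMonomial α n) := by
  unfold scaledMonomial
  fun_prop

theorem memBloch_scaledMonomial {α : ℝ} (hα0 : 0 < α) (hα1 : α < 1) (n : ℕ) :
    MemBloch α (scaledMonomial α n) :=
  ⟨(differentiable_scaledMonomial α n).differentiableOn,
    bddAbove_weighted fun _ hz => weight_mul_deriv_scaledMonomial_le hα0 hα1 n hz⟩

theorem scaledMonomial_zero_right (α : ℝ) (n : ℕ) : scaledMonomial α n 0 = 0 := by
  simp [scaledMonomial]

theorem blochNorm_scaledMonomial_le {α : ℝ} (hα0 : 0 < α) (hα1 : α < 1) (n : ℕ) :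
    blochNorm α (scaledMonomial α n) ≤ 1 := by
  rw [blochNorm, scaledMonomial_zero_right, norm_zero, zero_add]
  exact wnorm_le zero_le_one fun _ hz => weight_mul_deriv_scaledMonomial_le hα0 hα1 n hz

theorem exists_weight_le {α : ℝ} (hα0 : 0 < α) {η : ℝ} (hη : 0 < η) :
    ∃ s : ℝ, 0 < s ∧ s < 1 ∧ ∀ x : ℝ, s ≤ x → x < 1 → (1 - x ^ 2) ^ α ≤ η := by
  have hc : ContinuousAt (fun x : ℝ => (1 - x ^ 2) ^ α) 1 :=
    ContinuousAt.rpow_const (by fun_prop) (Or.inr hα0.le)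
  have ht := hc.tendsto
  simp only [one_pow, sub_self, Real.zero_rpow hα0.ne'] at ht
  obtain ⟨δ, hδ, h⟩ := Metric.eventually_nhds_iff.mp (ht.eventually (ge_mem_nhds hη))
  refine ⟨max (1 / 2) (1 - δ / 2), by positivity, max_lt (by norm_num) (by linarith),
    fun x hx hx1 => h ?_⟩
  rw [Real.dist_eq, abs_lt]
  have := (le_max_right _ _).trans hx
  constructor <;> linarith

theorem eventually_weight_mul_deriv_add_le {α : ℝ} (hα0 : 0 < α) (hα1 : α < 1) {g : ℂ → ℂ}
    {A B η : ℝ} (hA : 1 ≤ A) (hη : 0 < η) (hB : ∀ z ∈ unitDisk, ‖g z‖ ≤ B)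
    (hg : ∀ z ∈ unitDisk, (1 - ‖z‖ ^ 2) ^ α * ‖g z‖ ≤ A) :
    ∀ᶠ n in atTop, ∀ z ∈ unitDisk,
      (1 - ‖z‖ ^ 2) ^ α * ‖g z + deriv (scaledMonomial α n) z‖ ≤ A + η := by
  have hB0 : 0 ≤ B := (norm_nonneg _).trans (hB 0 zero_mem_unitDisk)
  obtain ⟨s, hs0, hs1, hs⟩ := exists_weight_le hα0 (div_pos hη (by linarith : 0 < B + 1))
  have ht : Tendsto (fun n : ℕ => (n : ℝ) * s ^ n + s ^ n) atTop (nhds 0) := by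
    simpa using (tendsto_self_mul_const_pow_of_lt_one hs0.le hs1).add
      (tendsto_pow_atTop_nhds_zero_of_lt_one hs0.le hs1)
  filter_upwards [ht.eventually (ge_mem_nhds hη)] with n hn z hz
  have hz1 := mem_unitDisk.mp hz
  have hw := (weight_pos α hz).le
  have key : (1 - ‖z‖ ^ 2) ^ α * ‖g z + deriv (scaledMonomial α n) z‖ ≤
      (1 - ‖z‖ ^ 2) ^ α * ‖g z‖ + (1 - ‖z‖ ^ 2) ^ α * ‖deriv (scaledMonomial α n) z‖ := by
    rw [← mul_add]
    exact mul_le_mul_of_nonneg_left (norm_add_le _ _) hw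
  rcases le_total s ‖z‖ with h | h
  · have h1 : (1 - ‖z‖ ^ 2) ^ α * ‖g z‖ ≤ η := by
      calc (1 - ‖z‖ ^ 2) ^ α * ‖g z‖ ≤ η / (B + 1) * B := by
            gcongr
            · exact hs _ h hz1
            · exact hB z hz
        _ ≤ η := by
            rw [div_mul_eq_mul_div, div_le_iff₀ (by linarith)]
            nlinarith
    have h2 := weight_mul_deriv_scaledMonomial_le hα0 hα1 n hz
    linarith
  · have h1 : (1 - ‖z‖ ^ 2) ^ α * ‖deriv (scaledMonomial α n) z‖ ≤ η := by
      calc (1 - ‖z‖ ^ 2) ^ α * ‖deriv (scaledMonomial α n) z‖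
          ≤ 1 * ‖deriv (scaledMonomial α n) z‖ := by
            gcongr
            exact weight_le_one hα0.le hz
        _ = ((n : ℝ) + 1) ^ α / 2 * ‖z‖ ^ n := by rw [one_mul, norm_deriv_scaledMonomial]
        _ ≤ ((n : ℝ) + 1) ^ (1 : ℝ) / 1 * s ^ n := by
            gcongr
            · linarith
            · norm_num
        _ ≤ η := by
            rw [Real.rpow_one]
            linarith
    linarith [hg z hz]

theorem eventually_zygNorm_scaledMonomial_le {α β : ℝ} (hα0 : 0 < α) (hα1 : α < 1)
    {K : (ℂ → ℂ) → ℂ → ℂ} (hK : IsCompactOpToZygmund α β (MemBloch α) K) {ε : ℝ} (hε : 0 < ε) :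
    ∀ᶠ n in atTop, zygNorm β (K (scaledMonomial α n)) ≤ ε := by
  obtain ⟨hlin, hmem, ⟨C, hC⟩, htb⟩ := hK
  have hbdd : ∀ f, MemBloch α f → zygNorm β (K f) ≤ max C 0 * blochNorm α f := fun f hf =>
    (hC f hf).trans (mul_le_mul_of_nonneg_right (le_max_left _ _) (blochNorm_nonneg _ _))
  have hC0 : 0 ≤ max C 0 := le_max_right _ _
  generalize max C 0 = C' at hbdd hC0
  by_contra hcon
  obtain ⟨T, hT, hT2⟩ := htb (ε / 4) (by linarith)
  have hfreq : ∃ g ∈ T, ∃ᶠ n in atTop, ε < zygNorm β (K (scaledMonomial α n)) ∧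
      zygNorm β (fun z => K (scaledMonomial α n) z - g z) ≤ ε / 4 := by
    by_contra! h
    have h2 := (Filter.eventually_all_finset T).mpr h
    refine hcon ?_
    filter_upwards [h2] with n hn
    by_contra! hlt
    obtain ⟨g, hg, hg2⟩ := hT2 _ (memBloch_scaledMonomial hα0 hα1 n)
      (blochNorm_scaledMonomial_le hα0 hα1 n)
    exact (hn g hg hlt).not_ge hg2
  obtain ⟨g, hgT, hfr⟩ := hfreq
  have hg := hT g hgT
  have hglow : 3 * ε / 4 ≤ zygNorm β g := by
    obtain ⟨n, h1, h2⟩ := hfr.exists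
    have := zygNorm_le_add_sub (hmem _ (memBloch_scaledMonomial hα0 hα1 n)) hg
    linarith
  set η : ℝ := ε / (4 * (C' + 1)) with hη
  have hη0 : 0 < η := by positivity
  have hind : ∀ k : ℕ, ∃ f, MemBloch α f ∧ f 0 = 0 ∧ (∃ B, ∀ z ∈ unitDisk, ‖deriv f z‖ ≤ B) ∧
      (∀ z ∈ unitDisk, (1 - ‖z‖ ^ 2) ^ α * ‖deriv f z‖ ≤ 1 + k * η) ∧
      zygNorm β (fun z => K f z - k * g z) ≤ k * (ε / 4) := by
    intro k
    induction k with
    | zero =>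
      have h0 : MemBloch α (fun _ => 0) :=
        ⟨differentiableOn_const _, bddAbove_weighted (c := 0) fun z _ => by simp⟩
      refine ⟨fun _ => 0, h0, rfl, ⟨0, fun z _ => by simp⟩, fun z _ => by simp, ?_⟩
      have hb : blochNorm α (fun _ => 0) ≤ 0 := by
        rw [blochNorm, norm_zero, zero_add]
        exact wnorm_le le_rfl fun z _ => by simp
      have := hbdd _ h0
      have : zygNorm β (K fun _ => 0) ≤ 0 := this.trans (mul_nonpos_of_nonneg_of_nonpos hC0 hb)
      simpa using this
    | succ k ih =>
      obtain ⟨f, hf, hf0, ⟨B, hB⟩, hfA, hfz⟩ := ih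
      have hev := eventually_weight_mul_deriv_add_le hα0 hα1
        (by have : 0 ≤ k * η := by positivity
            linarith : (1 : ℝ) ≤ 1 + k * η) hη0 hB hfA
      obtain ⟨n, ⟨-, hn2⟩, hn⟩ := (hfr.and_eventually hev).exists
      have he := memBloch_scaledMonomial hα0 hα1 n
      have hd : ∀ z ∈ unitDisk, deriv (fun z => 1 * f z + 1 * scaledMonomial α n z) z =
          deriv f z + deriv (scaledMonomial α n) z := fun z hz => by
        rw [deriv_lincomb hf.1 he.1 1 1 hz, one_mul, one_mul]
      refine ⟨fun z => 1 * f z + 1 * scaledMonomial α n z, hf.lincomb he 1 1, ?_,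
        ⟨B + ((n : ℝ) + 1) ^ α / 2, fun z hz => ?_⟩, fun z hz => ?_, ?_⟩
      · simp [hf0, scaledMonomial_zero_right]
      · rw [hd z hz]
        refine (norm_add_le _ _).trans (add_le_add (hB z hz) ?_)
        rw [norm_deriv_scaledMonomial]
        exact mul_le_of_le_one_right (by positivity)
          (pow_le_one₀ (norm_nonneg _) (mem_unitDisk.mp hz).le)
      · rw [hd z hz]
        refine (hn z hz).trans (le_of_eq ?_)
        push_cast
        ring
      · have hkg : MemZygmund β (fun z => K f z - k * g z) := by
          simpa [sub_eq_add_neg] using (hmem f hf).lincomb hg 1 (-k)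
        have := zygNorm_lincomb_le hkg ((hmem _ he).sub hg) 1 1
        rw [hlin f _ hf he 1 1]
        have e : (fun z => 1 * K f z + 1 * K (scaledMonomial α n) z - ((k + 1 : ℕ) : ℂ) * g z) =
            fun z => 1 * (K f z - k * g z) + 1 * (K (scaledMonomial α n) z - g z) := by
          funext z
          push_cast
          ring
        rw [e]
        refine this.trans ?_
        rw [norm_one]
        push_cast
        linarith
  obtain ⟨k, hk⟩ := exists_nat_gt (4 * C' / ε)
  obtain ⟨f, hf, hf0, -, hfA, hfz⟩ := hind k
  have hfn : blochNorm α f ≤ 1 + k * η := by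
    rw [blochNorm, hf0, norm_zero, zero_add]
    exact wnorm_le (by positivity) hfA
  have h1 := hbdd f hf
  have hkg : MemZygmund β (fun z => K f z - k * g z) := by
    simpa [sub_eq_add_neg] using (hmem f hf).lincomb hg 1 (-k)
  have h2 : k * zygNorm β g ≤ zygNorm β (K f) + zygNorm β (fun z => K f z - k * g z) := by
    rcases Nat.eq_zero_or_pos k with rfl | hkpos
    · have := zygNorm_nonneg β (K f)
      have := zygNorm_nonneg β (fun z => K f z - (0 : ℕ) * g z)
      simpa using by positivity
    have hk0 : (k : ℂ) ≠ 0 := by exact_mod_cast hkpos.ne'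
    have := zygNorm_lincomb_le (hmem f hf) hkg (1 / k) (-(1 / k))
    have e : (fun z => 1 / (k : ℂ) * K f z + -(1 / (k : ℂ)) * (K f z - k * g z)) = g := by
      funext z
      field_simp
      ring
    rw [e, norm_neg, norm_div, norm_one, Complex.norm_natCast] at this
    have hk' : (0 : ℝ) < k := by exact_mod_cast hkpos
    calc k * zygNorm β g ≤ k * _ := mul_le_mul_of_nonneg_left this hk'.le
      _ = _ := by
        field_simp
  have h3 : C' * blochNorm α f ≤ C' * (1 + k * η) := mul_le_mul_of_nonneg_left hfn hC0
  have h4 : C' * η ≤ ε / 4 := by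
    rw [hη, mul_div_assoc', div_le_div_iff₀ (by positivity) (by norm_num)]
    nlinarith
  have hk' : (0 : ℝ) ≤ k := by positivity
  have h5 : (k : ℝ) * (3 * ε / 4) ≤ k * zygNorm β g := mul_le_mul_of_nonneg_left hglow hk'
  have h6 := mul_le_mul_of_nonneg_left h4 hk'
  rw [div_lt_iff₀ hε] at hk
  nlinarith

theorem rpow_succ_mul_pow_le {α ν : ℝ} (hα0 : 0 < α) (hα1 : α < 1) (hν : 0 ≤ ν) {x y a : ℂ}
    (ha : ‖a‖ ≤ 1) {E : ℕ → ℝ}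
    (h : ∀ n : ℕ, ((n : ℝ) + 1) ^ α * (ν * ‖x * a ^ n + n * y * a ^ (n - 1)‖) ≤ E n) (m : ℕ) :
    ((m : ℝ) + 1) ^ α * (ν * ‖x * a ^ m‖) ≤ 2 * (2 * E (m / 2) + E (2 * (m / 2))) ∧
    (2 ≤ m → ((m : ℝ) + 1) ^ (α + 1) * (ν * ‖y * a ^ m‖) ≤
      8 * (E (m / 2) + E (2 * (m / 2)))) := by
  obtain ⟨n, hn⟩ : ∃ n, n = m / 2 := ⟨_, rfl⟩
  rw [← hn]
  set X := x * a ^ n + n * y * a ^ (n - 1) with hX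
  set Y := x * a ^ (2 * n) + (2 * n : ℕ) * y * a ^ (2 * n - 1) with hY
  set p : ℝ := ((n : ℝ) + 1) ^ α with hp
  have hp0 : 0 ≤ p := by positivity
  have hEX : p * (ν * ‖X‖) ≤ E n := h n
  have hEY : p * (ν * ‖Y‖) ≤ E (2 * n) := by
    refine le_trans ?_ (h (2 * n))
    rw [hp]
    gcongr
    linarith [(Nat.cast_nonneg n : (0 : ℝ) ≤ n)]
  have hm1 : ((m : ℝ) + 1) ^ α ≤ 2 * p := by
    calc ((m : ℝ) + 1) ^ α ≤ (2 * ((n : ℝ) + 1)) ^ α := by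
          refine Real.rpow_le_rpow (by positivity) ?_ hα0.le
          have : m + 1 ≤ 2 * (n + 1) := by omega
          exact_mod_cast this
      _ = 2 ^ α * p := Real.mul_rpow (by norm_num) (by positivity)
      _ ≤ 2 ^ (1 : ℝ) * p := by
          gcongr
          norm_num
      _ = 2 * p := by norm_num
  have han : ‖a ^ n‖ ≤ 1 := by
    rw [norm_pow]
    exact pow_le_one₀ (norm_nonneg _) ha
  have hmul : (n : ℂ) * (a ^ n * a ^ (n - 1)) = n * a ^ (2 * n - 1) := by
    rcases Nat.eq_zero_or_pos n with h0 | h0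
    · simp [h0]
    · rw [← pow_add]
      congr 2
      omega
  have hx : x * a ^ (2 * n) = 2 * (a ^ n * X) - Y := by
    rw [hX, hY]
    push_cast
    linear_combination (-2 * y) * hmul
  have hy : n * y * a ^ (2 * n - 1) = Y - a ^ n * X := by
    rw [hX, hY]
    push_cast
    linear_combination y * hmul
  have haX : ‖a ^ n * X‖ ≤ ‖X‖ := by
    rw [norm_mul]
    exact mul_le_of_le_one_left (norm_nonneg _) han
  have hpν : 0 ≤ p * ν := mul_nonneg hp0 hν
  constructor
  · have h1 : ‖x * a ^ m‖ ≤ 2 * ‖X‖ + ‖Y‖ := by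
      calc ‖x * a ^ m‖ ≤ ‖x * a ^ (2 * n)‖ := by
            rw [norm_mul, norm_mul, norm_pow, norm_pow]
            gcongr ?_ * ?_
            exact pow_le_pow_of_le_one (norm_nonneg _) ha (by omega)
        _ ≤ ‖2 * (a ^ n * X)‖ + ‖Y‖ := by
            rw [hx]
            exact norm_sub_le _ _
        _ ≤ 2 * ‖X‖ + ‖Y‖ := by
            rw [norm_mul]
            simpa using haX
    calc ((m : ℝ) + 1) ^ α * (ν * ‖x * a ^ m‖) ≤ (2 * p) * (ν * (2 * ‖X‖ + ‖Y‖)) := by gcongr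
      _ = 2 * (2 * (p * (ν * ‖X‖)) + p * (ν * ‖Y‖)) := by ring
      _ ≤ _ := by linarith
  · intro hm
    have hn1 : 1 ≤ n := by omega
    have h1 : n * ‖y * a ^ m‖ ≤ ‖X‖ + ‖Y‖ := by
      calc n * ‖y * a ^ m‖ ≤ n * ‖y * a ^ (2 * n - 1)‖ := by
            rw [norm_mul, norm_mul, norm_pow, norm_pow]
            gcongr ?_ * (?_ * ?_)
            exact pow_le_pow_of_le_one (norm_nonneg _) ha (by omega)
        _ = ‖Y - a ^ n * X‖ := by
            rw [← hy, norm_mul, norm_mul, norm_mul, Complex.norm_natCast, mul_assoc]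
        _ ≤ ‖X‖ + ‖Y‖ := by
            refine (norm_sub_le _ _).trans ?_
            linarith
    have hm2 : (m : ℝ) + 1 ≤ 4 * n := by
      have : m + 1 ≤ 4 * n := by omega
      exact_mod_cast this
    calc ((m : ℝ) + 1) ^ (α + 1) * (ν * ‖y * a ^ m‖)
        = ((m : ℝ) + 1) ^ α * ((m : ℝ) + 1) * (ν * ‖y * a ^ m‖) := by
          rw [Real.rpow_add_one (by positivity)]
      _ ≤ (2 * p) * (4 * n) * (ν * ‖y * a ^ m‖) := by gcongr
      _ = 8 * (p * ν) * (n * ‖y * a ^ m‖) := by ring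
      _ ≤ 8 * (p * ν) * (‖X‖ + ‖Y‖) := by gcongr
      _ = 8 * (p * (ν * ‖X‖) + p * (ν * ‖Y‖)) := by ring
      _ ≤ _ := by linarith

theorem memBloch_const (α : ℝ) (c : ℂ) : MemBloch α (fun _ => c) :=
  ⟨differentiableOn_const _, bddAbove_weighted (c := 0) fun z _ => by simp⟩

theorem BoundedBlochToZygmund.exists_weight_mul_deriv_deriv_le {α β : ℝ} {u φ : ℂ → ℂ}
    (hb : BoundedBlochToZygmund α β u φ) :
    ∃ B, 0 ≤ B ∧ ∀ z ∈ unitDisk, (1 - ‖z‖ ^ 2) ^ β * ‖deriv (deriv u) z‖ ≤ B := by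
  have h := hb.1 _ (memBloch_const α 1)
  have e : wcomp u φ (fun _ => 1) = u := by
    funext z
    simp [wcomp]
  rw [e] at h
  exact ⟨_, wnorm_nonneg _ _, fun z hz => le_wnorm h.2 hz⟩

theorem rpow_mul_weight_scaledMonomial_le {α β : ℝ} (hα0 : 0 < α) (hα1 : α < 1)
    {u φ : ℂ → ℂ} (hu : DifferentiableOn ℂ u unitDisk) (hφ : DifferentiableOn ℂ φ unitDisk)
    (hm : MapsTo φ unitDisk unitDisk) (hb : BoundedBlochToZygmund α β u φ) {B : ℝ}
    (hB : ∀ z ∈ unitDisk, (1 - ‖z‖ ^ 2) ^ β * ‖deriv (deriv u) z‖ ≤ B) {D : ℕ → ℝ}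
    (hD : ∀ n, zygNorm β (wcomp u φ (scaledMonomial α n)) ≤ D n) {z : ℂ} (hz : z ∈ unitDisk)
    (n : ℕ) :
    ((n : ℝ) + 1) ^ α * ((1 - ‖z‖ ^ 2) ^ β *
      ‖(2 * deriv u z * deriv φ z + u z * deriv (deriv φ) z) * φ z ^ n +
        n * (u z * deriv φ z ^ 2) * φ z ^ (n - 1)‖) ≤
      2 * D n + B * ((n : ℝ) + 1) ^ (α - 1) := by
  have hmem := hb.1 _ (memBloch_scaledMonomial hα0 hα1 n)
  have h1 : (1 - ‖z‖ ^ 2) ^ β * ‖deriv (deriv (wcomp u φ (scaledMonomial α n))) z‖ ≤ D n := by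
    refine (le_wnorm hmem.2 hz).trans (le_trans ?_ (hD n))
    unfold zygNorm
    linarith [norm_nonneg (wcomp u φ (scaledMonomial α n) 0),
      norm_nonneg (deriv (wcomp u φ (scaledMonomial α n)) 0)]
  have hf := deriv_deriv_wcomp hu hφ hm (memBloch_scaledMonomial hα0 hα1 n).1 hz
  rw [deriv_deriv_scaledMonomial, deriv_scaledMonomial] at hf
  set F := deriv (deriv (wcomp u φ (scaledMonomial α n))) z
  set S := (2 * deriv u z * deriv φ z + u z * deriv (deriv φ) z) * φ z ^ n +
        n * (u z * deriv φ z ^ 2) * φ z ^ (n - 1) with hS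
  have hfS : (((((n : ℝ) + 1) ^ α : ℝ)) : ℂ) * S =
      2 * F - 2 * (deriv (deriv u) z * scaledMonomial α n (φ z)) := by
    rw [hf, hS]
    push_cast
    ring
  have hsm : ‖scaledMonomial α n (φ z)‖ ≤ ((n : ℝ) + 1) ^ (α - 1) / 2 := by
    have hq : (0 : ℝ) ≤ ((n : ℝ) + 1) ^ (α - 1) / 2 := by positivity
    rw [scaledMonomial, norm_mul, norm_pow, Complex.norm_real, Real.norm_eq_abs,
      abs_of_nonneg hq]
    exact mul_le_of_le_one_right hq
      (pow_le_one₀ (norm_nonneg _) (mem_unitDisk.mp (hm hz)).le)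
  have hν := (weight_pos β hz).le
  have hnS : ((n : ℝ) + 1) ^ α * ‖S‖ = ‖(((((n : ℝ) + 1) ^ α : ℝ)) : ℂ) * S‖ := by
    rw [norm_mul, Complex.norm_real, Real.norm_eq_abs, abs_of_nonneg (by positivity)]
  calc ((n : ℝ) + 1) ^ α * ((1 - ‖z‖ ^ 2) ^ β * ‖S‖)
      = (1 - ‖z‖ ^ 2) ^ β * ‖(((((n : ℝ) + 1) ^ α : ℝ)) : ℂ) * S‖ := by
        rw [← hnS]
        ring
    _ ≤ (1 - ‖z‖ ^ 2) ^ β *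
        (2 * ‖F‖ + 2 * (‖deriv (deriv u) z‖ * ‖scaledMonomial α n (φ z)‖)) := by
        gcongr
        rw [hfS]
        refine (norm_sub_le _ _).trans (le_of_eq ?_)
        simp only [norm_mul, Complex.norm_ofNat]
    _ = 2 * ((1 - ‖z‖ ^ 2) ^ β * ‖F‖) + 2 * (((1 - ‖z‖ ^ 2) ^ β * ‖deriv (deriv u) z‖) *
          ‖scaledMonomial α n (φ z)‖) := by ring
    _ ≤ 2 * D n + 2 * (B * (((n : ℝ) + 1) ^ (α - 1) / 2)) := by
        gcongr
        · exact (mul_nonneg hν (norm_nonneg _)).trans (hB z hz)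
        · exact hB z hz
    _ = _ := by ring

theorem rpow_mul_wnorm_le {α β : ℝ} (hα0 : 0 < α) (hα1 : α < 1)
    {u φ : ℂ → ℂ} (hu : DifferentiableOn ℂ u unitDisk) (hφ : DifferentiableOn ℂ φ unitDisk)
    (hm : MapsTo φ unitDisk unitDisk) (hb : BoundedBlochToZygmund α β u φ) {B : ℝ} (hB0 : 0 ≤ B)
    (hB : ∀ z ∈ unitDisk, (1 - ‖z‖ ^ 2) ^ β * ‖deriv (deriv u) z‖ ≤ B) {D : ℕ → ℝ}
    (hD : ∀ n, zygNorm β (wcomp u φ (scaledMonomial α n)) ≤ D n) {n : ℕ} {d : ℝ}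
    (hd1 : 2 * D (n / 2) + B * (((n / 2 : ℕ) : ℝ) + 1) ^ (α - 1) ≤ d)
    (hd2 : 2 * D (2 * (n / 2)) + B * (((2 * (n / 2) : ℕ) : ℝ) + 1) ^ (α - 1) ≤ d) :
    ((n : ℝ) + 1) ^ α * wnorm β (fun z =>
      (2 * deriv u z * deriv φ z + u z * deriv (deriv φ) z) * φ z ^ n) ≤ 16 * d ∧
    (2 ≤ n → ((n : ℝ) + 1) ^ (α + 1) *
      wnorm β (fun z => u z * deriv φ z ^ 2 * φ z ^ n) ≤ 16 * d) := by
  have hd0 : 0 ≤ d := by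
    refine le_trans ?_ hd1
    have := (zygNorm_nonneg β _).trans (hD (n / 2))
    positivity
  have key := fun z hz => rpow_succ_mul_pow_le (x := 2 * deriv u z * deriv φ z +
      u z * deriv (deriv φ) z) (y := u z * deriv φ z ^ 2) hα0 hα1 (weight_pos β hz).le
    (mem_unitDisk.mp (hm hz)).le
    (fun k => rpow_mul_weight_scaledMonomial_le hα0 hα1 hu hφ hm hb hB hD hz k) n
  constructor
  · rw [← le_div_iff₀' (by positivity)]
    refine wnorm_le (by positivity) fun z hz => ?_
    rw [le_div_iff₀' (by positivity)]
    linarith [(key z hz).1]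
  · intro hn
    rw [← le_div_iff₀' (by positivity)]
    refine wnorm_le (by positivity) fun z hz => ?_
    rw [le_div_iff₀' (by positivity)]
    linarith [(key z hz).2 hn]

theorem limsup_le_of_forall_pos {a : ℕ → ℝ} {L : ℝ} (ha : ∀ n, 0 ≤ a n)
    (h : ∀ ε > 0, ∀ᶠ n in atTop, a n ≤ L + ε) : limsup a atTop ≤ L := by
  refine le_of_forall_pos_le_add fun ε hε => ?_
  exact limsup_le_of_le (isCoboundedUnder_le_of_le atTop (x := 0) ha) (h ε hε)

theorem zygNorm_wcomp_sub_le_sSup {α β : ℝ} {u φ : ℂ → ℂ}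
    (hb : BoundedBlochToZygmund α β u φ) {K : (ℂ → ℂ) → ℂ → ℂ}
    (hK : IsCompactOpToZygmund α β (MemBloch α) K) {f : ℂ → ℂ} (hf : MemBloch α f)
    (hf1 : blochNorm α f ≤ 1) :
    zygNorm β (fun z => wcomp u φ f z - K f z) ≤
      sSup {s | ∃ f, MemBloch α f ∧ blochNorm α f ≤ 1 ∧
        s = zygNorm β (fun z => wcomp u φ f z - K f z)} := by
  obtain ⟨-, hmem, ⟨C, hC⟩, -⟩ := hK
  obtain ⟨C₁, hC₁, hb₁⟩ := hb.2
  refine le_csSup ⟨C₁ + max C 0, ?_⟩ ⟨f, hf, hf1, rfl⟩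
  rintro _ ⟨g, hg, hg1, rfl⟩
  have h0 := blochNorm_nonneg α g
  refine (zygNorm_sub_le (hb.1 g hg) (hmem g hg)).trans (add_le_add ?_ ?_)
  · exact (hb₁ g hg).trans (mul_le_of_le_one_right hC₁.le hg1)
  · refine (hC g hg).trans ?_
    exact (mul_le_mul_of_nonneg_right (le_max_left C 0) h0).trans
      (mul_le_of_le_one_right (le_max_right _ _) hg1)

theorem tendsto_mul_rpow_sub_one {α : ℝ} (hα1 : α < 1) (B : ℝ) :
    Tendsto (fun n : ℕ => B * ((n : ℝ) + 1) ^ (α - 1)) atTop (nhds 0) := by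
  have h1 : Tendsto (fun n : ℕ => (n : ℝ) + 1) atTop atTop :=
    tendsto_atTop_add_const_right _ _ tendsto_natCast_atTop_atTop
  have h2 := ((tendsto_rpow_neg_atTop (by linarith : 0 < 1 - α)).comp h1).const_mul B
  simpa [Function.comp_def] using h2

theorem tendsto_two_mul_half : Tendsto (fun n : ℕ => 2 * (n / 2)) atTop atTop :=
  tendsto_atTop_mono (fun _ => Nat.le_mul_of_pos_left _ two_pos)
    (Nat.tendsto_div_const_atTop two_ne_zero)

theorem limsup_le_sSup_of_isCompactOp {α β : ℝ} (hα0 : 0 < α) (hα1 : α < 1)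
    {u φ : ℂ → ℂ} (hu : DifferentiableOn ℂ u unitDisk) (hφ : DifferentiableOn ℂ φ unitDisk)
    (hm : MapsTo φ unitDisk unitDisk) (hb : BoundedBlochToZygmund α β u φ)
    {K : (ℂ → ℂ) → ℂ → ℂ} (hK : IsCompactOpToZygmund α β (MemBloch α) K) :
    max (limsup (fun n : ℕ => ((n : ℝ) + 1) ^ α * wnorm β (fun z =>
          (2 * deriv u z * deriv φ z + u z * deriv (deriv φ) z) * φ z ^ n)) atTop)
        (limsup (fun n : ℕ => ((n : ℝ) + 1) ^ (α + 1) * wnorm β (fun z =>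
          u z * deriv φ z ^ 2 * φ z ^ n)) atTop) ≤
      32 * sSup {s | ∃ f, MemBloch α f ∧ blochNorm α f ≤ 1 ∧
        s = zygNorm β (fun z => wcomp u φ f z - K f z)} := by
  set R := sSup {s | ∃ f, MemBloch α f ∧ blochNorm α f ≤ 1 ∧
        s = zygNorm β (fun z => wcomp u φ f z - K f z)} with hR
  obtain ⟨B, hB0, hB⟩ := hb.exists_weight_mul_deriv_deriv_le
  have hD : ∀ n, zygNorm β (wcomp u φ (scaledMonomial α n)) ≤
      zygNorm β (K (scaledMonomial α n)) + R := fun n => by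
    have he := memBloch_scaledMonomial hα0 hα1 n
    have h1 := zygNorm_le_add_sub (hb.1 _ he) (hK.2.1 _ he)
    have h2 := zygNorm_wcomp_sub_le_sSup hb hK he (blochNorm_scaledMonomial_le hα0 hα1 n)
    linarith
  have hev : ∀ ε > 0, ∀ᶠ n : ℕ in atTop, 2 * (zygNorm β (K (scaledMonomial α n)) + R) +
      B * ((n : ℝ) + 1) ^ (α - 1) ≤ 2 * R + ε := fun ε hε => by
    filter_upwards [eventually_zygNorm_scaledMonomial_le hα0 hα1 hK (by positivity : 0 < ε / 4),
      (tendsto_mul_rpow_sub_one hα1 B).eventually (ge_mem_nhds (by positivity : 0 < ε / 2))]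
      with n h1 h2
    linarith
  have hev2 : ∀ ε > 0, ∀ᶠ n : ℕ in atTop,
      ((n : ℝ) + 1) ^ α * wnorm β (fun z =>
        (2 * deriv u z * deriv φ z + u z * deriv (deriv φ) z) * φ z ^ n) ≤ 32 * R + ε ∧
      ((n : ℝ) + 1) ^ (α + 1) *
        wnorm β (fun z => u z * deriv φ z ^ 2 * φ z ^ n) ≤ 32 * R + ε := fun ε hε => by
    have h := hev (ε / 16) (by positivity)
    filter_upwards [(Nat.tendsto_div_const_atTop two_ne_zero).eventually h,
      tendsto_two_mul_half.eventually h, eventually_ge_atTop 2] with n h1 h2 h3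
    have := rpow_mul_wnorm_le hα0 hα1 hu hφ hm hb hB0 hB hD h1 h2
    have h4 := this.2 h3
    exact ⟨by linarith [this.1], by linarith⟩
  refine max_le
    (limsup_le_of_forall_pos (fun n => ?_) fun ε hε => (hev2 ε hε).mono fun _ h => h.1)
    (limsup_le_of_forall_pos (fun n => ?_) fun ε hε => (hev2 ε hε).mono fun _ h => h.2)
  · exact mul_nonneg (by positivity) (wnorm_nonneg _ _)
  · exact mul_nonneg (by positivity) (wnorm_nonneg _ _)

theorem one_sub_norm_rpow_neg_anti {p x y : ℝ} (hp : 0 ≤ p) (hxy : x ≤ y) (hy : y < 1) :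
    (1 - x) ^ (-p) ≤ (1 - y) ^ (-p) :=
  Real.rpow_le_rpow_of_nonpos (by linarith) (by linarith) (by linarith)

theorem norm_deriv_le_of_blochNorm_le_one {α : ℝ} (hα0 : 0 < α) {f : ℂ → ℂ} (hf : MemBloch α f)
    (hf1 : blochNorm α f ≤ 1) {z : ℂ} (hz : z ∈ unitDisk) :
    ‖deriv f z‖ ≤ (1 - ‖z‖) ^ (-α) := by
  have hz1 := mem_unitDisk.mp hz
  have hd : 0 < (1 - ‖z‖) ^ α := Real.rpow_pos_of_pos (by linarith) _
  have h1 : (1 - ‖z‖) ^ α ≤ (1 - ‖z‖ ^ 2) ^ α :=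
    Real.rpow_le_rpow (by linarith) (by nlinarith [norm_nonneg z]) hα0.le
  have h2 : (1 - ‖z‖ ^ 2) ^ α * ‖deriv f z‖ ≤ 1 := by
    refine (le_wnorm hf.2 hz).trans (le_trans ?_ hf1)
    unfold blochNorm
    linarith [norm_nonneg (f 0)]
  rw [Real.rpow_neg (by linarith), ← one_div, le_div_iff₀' hd]
  exact (mul_le_mul_of_nonneg_right h1 (norm_nonneg _)).trans h2

theorem norm_deriv_le_div_of_norm_le {g : ℂ → ℂ} (hg : DifferentiableOn ℂ g unitDisk) {z : ℂ}
    {R C : ℝ} (hR : 0 < R) (hz : ‖z‖ + R < 1) (h : ∀ w : ℂ, ‖w‖ ≤ ‖z‖ + R → ‖g w‖ ≤ C) :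
    ‖deriv g z‖ ≤ C / R := by
  have hw : ∀ w ∈ Metric.closedBall z R, ‖w‖ ≤ ‖z‖ + R := fun w hw => by
    rw [Metric.mem_closedBall, dist_eq_norm] at hw
    have := norm_add_le z (w - z)
    rw [add_sub_cancel] at this
    linarith
  refine Complex.norm_deriv_le_of_forall_mem_sphere_norm_le hR ?_
    fun w hws => h w (hw w (Metric.sphere_subset_closedBall hws))
  refine (hg.mono fun w hw' => ?_).diffContOnCl
  rw [closure_ball z hR.ne'] at hw'
  exact mem_unitDisk.mpr ((hw w hw').trans_lt hz)

theorem norm_deriv_deriv_le_of_blochNorm_le_one {α : ℝ} (hα0 : 0 < α) (hα1 : α < 1) {f : ℂ → ℂ}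
    (hf : MemBloch α f) (hf1 : blochNorm α f ≤ 1) {z : ℂ} (hz : z ∈ unitDisk) :
    ‖deriv (deriv f) z‖ ≤ 4 * (1 - ‖z‖) ^ (-(α + 1)) := by
  have hz1 := mem_unitDisk.mp hz
  have hR : 0 < (1 - ‖z‖) / 2 := by linarith
  have h := norm_deriv_le_div_of_norm_le (z := z) (differentiableOn_deriv hf.1) hR (by linarith)
    (C := ((1 - ‖z‖) / 2) ^ (-α)) fun w hw => by
      refine (norm_deriv_le_of_blochNorm_le_one hα0 hf hf1
        (mem_unitDisk.mpr (by linarith))).trans ?_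
      refine (one_sub_norm_rpow_neg_anti hα0.le hw (by linarith)).trans (le_of_eq ?_)
      congr 1
      ring
  calc ‖deriv (deriv f) z‖ ≤ ((1 - ‖z‖) / 2) ^ (-α) / ((1 - ‖z‖) / 2) := h
    _ = ((1 - ‖z‖) / 2) ^ (-(α + 1)) := by
        rw [← Real.rpow_sub_one hR.ne']
        congr 1
        ring
    _ = 2 ^ (α + 1) * (1 - ‖z‖) ^ (-(α + 1)) := by
        rw [Real.div_rpow (by linarith) (by norm_num), Real.rpow_neg two_pos.le, div_inv_eq_mul,
          mul_comm]
    _ ≤ 2 ^ (2 : ℝ) * (1 - ‖z‖) ^ (-(α + 1)) := by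
        refine mul_le_mul_of_nonneg_right
          (Real.rpow_le_rpow_of_exponent_le (by norm_num) (by linarith))
          (Real.rpow_nonneg (by linarith) _)
    _ = 4 * (1 - ‖z‖) ^ (-(α + 1)) := by norm_num

theorem real_mul_mem_unitDisk {r : ℝ} (hr0 : 0 ≤ r) (hr1 : r ≤ 1) {z : ℂ} (hz : z ∈ unitDisk) :
    (r : ℂ) * z ∈ unitDisk := by
  rw [mem_unitDisk] at hz ⊢
  rw [norm_mul, Complex.norm_real, Real.norm_eq_abs, abs_of_nonneg hr0]
  nlinarith [norm_nonneg z]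

theorem norm_real_mul_le {r : ℝ} (hr0 : 0 ≤ r) (hr1 : r ≤ 1) (z : ℂ) : ‖(r : ℂ) * z‖ ≤ ‖z‖ := by
  rw [norm_mul, Complex.norm_real, Real.norm_eq_abs, abs_of_nonneg hr0]
  exact mul_le_of_le_one_left (norm_nonneg z) hr1

theorem deriv_dilation (f : ℂ → ℂ) (r : ℝ) (z : ℂ) :
    deriv (fun z => f ((r : ℂ) * z)) z = r * deriv f (r * z) := by
  rw [deriv_comp_mul_left, smul_eq_mul]

theorem weight_mul_deriv_dilation_le {α : ℝ} (hα0 : 0 < α) {f : ℂ → ℂ} (hf : MemBloch α f)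
    {r : ℝ} (hr0 : 0 ≤ r) (hr1 : r ≤ 1) {z : ℂ} (hz : z ∈ unitDisk) :
    (1 - ‖z‖ ^ 2) ^ α * ‖deriv (fun z => f ((r : ℂ) * z)) z‖ ≤ wnorm α (deriv f) := by
  have hrz := real_mul_mem_unitDisk hr0 hr1 hz
  refine le_trans ?_ (le_wnorm hf.2 hrz)
  rw [deriv_dilation]
  gcongr ?_ * ?_
  · exact (weight_pos α hrz).le
  · have h1 := one_sub_norm_sq_pos hz
    have h2 := norm_real_mul_le hr0 hr1 z
    gcongr
  · exact norm_real_mul_le hr0 hr1 _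

theorem MemBloch.dilation {α : ℝ} (hα0 : 0 < α) {f : ℂ → ℂ} (hf : MemBloch α f)
    {r : ℝ} (hr0 : 0 ≤ r) (hr1 : r ≤ 1) : MemBloch α (fun z => f ((r : ℂ) * z)) :=
  ⟨hf.1.comp (differentiableOn_id.const_mul _) fun _ hz => real_mul_mem_unitDisk hr0 hr1 hz,
    bddAbove_weighted fun _ hz => weight_mul_deriv_dilation_le hα0 hf hr0 hr1 hz⟩

theorem blochNorm_dilation_le {α : ℝ} (hα0 : 0 < α) {f : ℂ → ℂ} (hf : MemBloch α f)
    {r : ℝ} (hr0 : 0 ≤ r) (hr1 : r ≤ 1) :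
    blochNorm α (fun z => f ((r : ℂ) * z)) ≤ blochNorm α f := by
  have : wnorm α (deriv fun z => f ((r : ℂ) * z)) ≤ wnorm α (deriv f) :=
    wnorm_le (wnorm_nonneg _ _) fun z hz => weight_mul_deriv_dilation_le hα0 hf hr0 hr1 hz
  simp only [blochNorm, mul_zero]
  linarith

theorem norm_sub_dilation_le {α : ℝ} (hα0 : 0 < α) (hα1 : α < 1) {f : ℂ → ℂ}
    (hf : MemBloch α f) (hf1 : blochNorm α f ≤ 1) {r : ℝ} (hr0 : 0 ≤ r) (hr1 : r ≤ 1) {z : ℂ}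
    (hz : z ∈ unitDisk) : ‖f z - f ((r : ℂ) * z)‖ ≤ (1 - r) ^ (1 - α) / (1 - α) := by
  have hα : 0 < 1 - α := by linarith
  have hz1 := mem_unitDisk.mp hz
  have hF : ∀ t ∈ Icc r 1, HasDerivAt (fun t : ℝ => f ((t : ℂ) * z) - f ((r : ℂ) * z))
      (z * deriv f ((t : ℂ) * z)) t := fun t ht => by
    have htz := real_mul_mem_unitDisk (hr0.trans ht.1) ht.2 hz
    have h1 : HasDerivAt (fun t : ℂ => f (t * z)) (deriv f ((t : ℂ) * z) * (1 * z)) (t : ℂ) :=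
      HasDerivAt.comp (t : ℂ) (differentiableAt_of_mem hf.1 htz).hasDerivAt
        ((hasDerivAt_id (t : ℂ)).mul_const z)
    exact (h1.comp_ofReal.sub_const (f ((r : ℂ) * z))).congr_deriv (by ring)
  have hB : ∀ t ∈ Ico r 1, HasDerivAt
      (fun t : ℝ => ((1 - r) ^ (1 - α) - (1 - t) ^ (1 - α)) / (1 - α)) ((1 - t) ^ (-α)) t :=
    fun t ht => by
      have h1 : HasDerivAt (fun t : ℝ => 1 - t) (-1) t := by
        simpa using (hasDerivAt_id t).const_sub 1
      have h2 := ((h1.rpow_const (p := 1 - α) (Or.inl (by linarith [ht.2]))).const_sub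
        ((1 - r) ^ (1 - α))).div_const (1 - α)
      refine h2.congr_deriv ?_
      rw [show 1 - α - 1 = -α by ring]
      field_simp
  have key := image_norm_le_of_norm_deriv_right_le_deriv_boundary'
    (f := fun t : ℝ => f ((t : ℂ) * z) - f ((r : ℂ) * z))
    (B := fun t : ℝ => ((1 - r) ^ (1 - α) - (1 - t) ^ (1 - α)) / (1 - α))
    (fun t ht => (hF t ht).continuousAt.continuousWithinAt)
    (fun t ht => (hF t ⟨ht.1, ht.2.le⟩).hasDerivWithinAt) (by simp)
    (Continuous.continuousOn (by
      have : Continuous fun t : ℝ => (1 - t) ^ (1 - α) :=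
        (by fun_prop : Continuous fun t : ℝ => 1 - t).rpow_const fun _ => Or.inr hα.le
      fun_prop))
    (fun t ht => (hB t ht).hasDerivWithinAt)
    (fun t ht => by
      have htz := real_mul_mem_unitDisk (hr0.trans ht.1) ht.2.le hz
      have ht0 : 0 ≤ t := hr0.trans ht.1
      rw [norm_mul]
      refine (mul_le_of_le_one_left (norm_nonneg _) hz1.le).trans ?_
      refine (norm_deriv_le_of_blochNorm_le_one hα0 hf hf1 htz).trans ?_
      refine one_sub_norm_rpow_neg_anti hα0.le ?_ ht.2
      rw [norm_mul, Complex.norm_real, Real.norm_eq_abs, abs_of_nonneg ht0]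
      exact mul_le_of_le_one_right ht0 hz1.le)
    (right_mem_Icc.mpr hr1)
  simpa [Real.zero_rpow hα.ne'] using key

theorem exists_finite_net_deriv {α : ℝ} (hα0 : 0 < α) (hα1 : α < 1) {r : ℝ} (hr0 : 0 ≤ r)
    (hr1 : r < 1) {ε : ℝ} (hε : 0 < ε) :
    ∃ T : Finset (ℂ → ℂ), (∀ g ∈ T, MemBloch α g) ∧
      ∀ f, MemBloch α f → blochNorm α f ≤ 1 → ∃ g ∈ T, ‖f 0 - g 0‖ ≤ ε ∧
        ∀ z : ℂ, ‖z‖ ≤ r → ‖deriv f z - deriv g z‖ ≤ ε := by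
  classical
  let X := Metric.closedBall (0 : ℂ) r
  have : CompactSpace X := isCompact_iff_compactSpace.mp (isCompact_closedBall 0 r)
  have hX : ∀ x : X, ‖(x : ℂ)‖ ≤ r := fun x => mem_closedBall_zero_iff.mp x.2
  have hXD : ∀ x ∈ X, x ∈ unitDisk := fun x hx =>
    mem_unitDisk.mpr (lt_of_le_of_lt (hX ⟨x, hx⟩) hr1)
  let U := {f : ℂ → ℂ // MemBloch α f ∧ blochNorm α f ≤ 1}
  let G : U → X → ℂ × ℂ := fun f x => (deriv f.1 x, f.1 0)
  let L : NNReal := ⟨4 * (1 - r) ^ (-(α + 1)), by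
    have : 0 ≤ (1 - r) ^ (-(α + 1)) := Real.rpow_nonneg (by linarith) _
    positivity⟩
  have hG : ∀ f, LipschitzWith L (G f) := fun f => by
    refine LipschitzWith.of_dist_le_mul fun x y => ?_
    have h := Convex.norm_image_sub_le_of_norm_deriv_le (f := deriv f.1) (s := X) (C := L)
      (fun w hw => differentiableAt_of_mem (differentiableOn_deriv f.2.1.1) (hXD w hw))
      (fun w hw => (norm_deriv_deriv_le_of_blochNorm_le_one hα0 hα1 f.2.1 f.2.2 (hXD w hw)).trans
        (mul_le_mul_of_nonneg_left
          (one_sub_norm_rpow_neg_anti (by linarith) (hX ⟨w, hw⟩) hr1) (by norm_num)))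
      (convex_closedBall 0 r) y.2 x.2
    rw [Prod.dist_eq]
    simpa [G, dist_eq_norm, Subtype.dist_eq] using h
  let Φ : U → BoundedContinuousFunction X (ℂ × ℂ) := fun f =>
    BoundedContinuousFunction.mkOfCompact ⟨G f, (hG f).continuous⟩
  have hcomp : IsCompact (closure (range Φ)) := by
    refine BoundedContinuousFunction.arzela_ascoli
      (Metric.closedBall 0 ((1 - r) ^ (-α)) ×ˢ Metric.closedBall 0 1)
      ((isCompact_closedBall _ _).prod (isCompact_closedBall _ _)) _ ?_ ?_
    · rintro _ x ⟨f, rfl⟩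
      refine ⟨?_, ?_⟩
      · have h := norm_deriv_le_of_blochNorm_le_one hα0 f.2.1 f.2.2 (hXD x x.2)
        simpa [Φ, G] using h.trans (one_sub_norm_rpow_neg_anti hα0.le (hX x) hr1)
      · have h := f.2.2
        have h2 := wnorm_nonneg α (deriv f.1)
        unfold blochNorm at h
        simpa [Φ, G] using (by linarith : ‖f.1 0‖ ≤ 1)
    · refine (LipschitzWith.uniformEquicontinuous _ L ?_).equicontinuous
      rintro ⟨_, f, rfl⟩
      exact hG f
  obtain ⟨t, ht, htf, hcov⟩ :=
    Metric.finite_approx_of_totallyBounded (hcomp.totallyBounded.subset subset_closure) ε hε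
  have : Nonempty U :=
    ⟨⟨_, memBloch_scaledMonomial hα0 hα1 0, blochNorm_scaledMonomial_le hα0 hα1 0⟩⟩
  choose! ψ hψ using fun y (hy : y ∈ t) => ht hy
  refine ⟨htf.toFinset.image fun y => (ψ y).1, fun g hg => ?_, fun f hf hf1 => ?_⟩
  · obtain ⟨y, -, rfl⟩ := Finset.mem_image.mp hg
    exact (ψ y).2.1
  · have hmem := hcov (mem_range_self (⟨f, hf, hf1⟩ : U))
    simp only [mem_iUnion, exists_prop] at hmem
    obtain ⟨y, hy, hd⟩ := hmem
    have hdx : ∀ x : X, dist (G ⟨f, hf, hf1⟩ x) (G (ψ y) x) ≤ ε := fun x => by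
      rw [← hψ y hy] at hd
      exact (BoundedContinuousFunction.dist_coe_le_dist x).trans (Metric.mem_ball.mp hd).le
    refine ⟨(ψ y).1, Finset.mem_image.mpr ⟨y, htf.mem_toFinset.mpr hy, rfl⟩, ?_, fun z hz => ?_⟩
    · have := hdx ⟨0, by simpa [X] using hr0⟩
      rw [Prod.dist_eq, max_le_iff] at this
      simpa [G, dist_eq_norm] using this.2
    · have := hdx ⟨z, by simpa [X] using hz⟩
      rw [Prod.dist_eq, max_le_iff] at this
      simpa [G, dist_eq_norm] using this.1

theorem wcomp_sub (u φ f g : ℂ → ℂ) :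
    (fun z => wcomp u φ f z - wcomp u φ g z) = wcomp u φ (fun z => f z - g z) := by
  funext z
  simp only [wcomp]
  ring

theorem isCompactOpToZygmund_dilation {α β : ℝ} (hα0 : 0 < α) (hα1 : α < 1) {u φ : ℂ → ℂ}
    (hb : BoundedBlochToZygmund α β u φ) {r : ℝ} (hr0 : 0 ≤ r) (hr1 : r < 1) :
    IsCompactOpToZygmund α β (MemBloch α) (fun f => wcomp u φ fun z => f ((r : ℂ) * z)) := by
  classical
  obtain ⟨hmem, C, hC, hbd⟩ := hb
  refine ⟨fun f g _ _ a b => ?_, fun f hf => hmem _ (hf.dilation hα0 hr0 hr1.le),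
    ⟨C, fun f hf => ?_⟩, fun ε hε => ?_⟩
  · funext z
    simp only [wcomp]
    ring
  · exact (hbd _ (hf.dilation hα0 hr0 hr1.le)).trans
      (mul_le_mul_of_nonneg_left (blochNorm_dilation_le hα0 hf hr0 hr1.le) hC.le)
  · obtain ⟨T, hT, hnet⟩ := exists_finite_net_deriv hα0 hα1 hr0 hr1
      (by positivity : 0 < ε / (2 * C))
    refine ⟨T.image fun g => wcomp u φ fun z => g ((r : ℂ) * z), fun g hg => ?_,
      fun f hf hf1 => ?_⟩
    · obtain ⟨g, hgT, rfl⟩ := Finset.mem_image.mp hg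
      exact hmem _ ((hT g hgT).dilation hα0 hr0 hr1.le)
    · obtain ⟨g, hgT, h0, hd⟩ := hnet f hf hf1
      refine ⟨_, Finset.mem_image_of_mem _ hgT, ?_⟩
      have hfr := hf.dilation hα0 hr0 hr1.le
      have hgr := (hT g hgT).dilation hα0 hr0 hr1.le
      have hw : wnorm α (deriv fun z => f ((r : ℂ) * z) - g ((r : ℂ) * z)) ≤ ε / (2 * C) := by
        refine wnorm_le (by positivity) fun z hz => ?_
        have e : deriv (fun z => f ((r : ℂ) * z) - g ((r : ℂ) * z)) z =
            r * (deriv f (r * z) - deriv g (r * z)) := by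
          rw [deriv_fun_sub (differentiableAt_of_mem hfr.1 hz) (differentiableAt_of_mem hgr.1 hz),
            deriv_dilation, deriv_dilation, mul_sub]
        have hrz : ‖(r : ℂ) * z‖ ≤ r := by
          rw [norm_mul, Complex.norm_real, Real.norm_eq_abs, abs_of_nonneg hr0]
          exact mul_le_of_le_one_right hr0 (mem_unitDisk.mp hz).le
        rw [e]
        refine (mul_le_of_le_one_left (norm_nonneg _) (weight_le_one hα0.le hz)).trans ?_
        exact (norm_real_mul_le hr0 hr1.le _).trans (hd _ hrz)
      rw [wcomp_sub]
      refine (hbd _ (hfr.sub hgr)).trans ?_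
      have hn : blochNorm α (fun z => f ((r : ℂ) * z) - g ((r : ℂ) * z)) ≤ ε / C := by
        have : ε / C = ε / (2 * C) + ε / (2 * C) := by
          field_simp
          norm_num
        simp only [blochNorm, mul_zero]
        linarith
      calc C * _ ≤ C * (ε / C) := mul_le_mul_of_nonneg_left hn hC.le
        _ = ε := by field_simp

theorem mul_rpow_neg_le_of_pow_bound {p ν L : ℝ} {x a : ℂ} {N : ℕ} (hp0 : 0 ≤ p) (hp2 : p ≤ 2)
    (hν : 0 ≤ ν) (ha : ‖a‖ < 1) (haN : 1 - ‖a‖ ≤ 1 / (2 * ((N : ℝ) + 1)))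
    (h : ∀ n : ℕ, N ≤ n → ((n : ℝ) + 1) ^ p * (ν * ‖x * a ^ n‖) ≤ L) :
    ν * ‖x‖ * (1 - ‖a‖) ^ (-p) ≤ 8 * L := by
  set δ := 1 - ‖a‖ with hδ
  have hδ0 : 0 < δ := by linarith
  set n := ⌊1 / (2 * δ)⌋₊ with hn
  have hnle : (n : ℝ) ≤ 1 / (2 * δ) := Nat.floor_le (by positivity)
  have hnlt : 1 / (2 * δ) < (n : ℝ) + 1 := Nat.lt_floor_add_one _
  have hNn : N ≤ n := by
    refine Nat.le_floor ?_
    rw [le_div_iff₀ (by positivity)] at haN ⊢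
    nlinarith [(Nat.cast_nonneg N : (0 : ℝ) ≤ N)]
  have hpow : 1 / 2 ≤ ‖a‖ ^ n := by
    have hb := one_add_mul_le_pow (a := -δ) (by linarith [norm_nonneg a]) n
    have e : 1 + -δ = ‖a‖ := by rw [hδ]; ring
    rw [e] at hb
    rw [le_div_iff₀ (by positivity)] at hnle
    linarith
  have hrp : δ ^ (-p) ≤ 4 * ((n : ℝ) + 1) ^ p := by
    have h1 : δ⁻¹ ≤ 2 * ((n : ℝ) + 1) := by
      rw [div_lt_iff₀ (by positivity)] at hnlt
      rw [inv_le_iff_one_le_mul₀ hδ0]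
      linarith
    calc δ ^ (-p) = (δ⁻¹) ^ p := by rw [Real.rpow_neg hδ0.le, Real.inv_rpow hδ0.le]
      _ ≤ (2 * ((n : ℝ) + 1)) ^ p := Real.rpow_le_rpow (by positivity) h1 hp0
      _ = 2 ^ p * ((n : ℝ) + 1) ^ p := Real.mul_rpow (by norm_num) (by positivity)
      _ ≤ 2 ^ (2 : ℝ) * ((n : ℝ) + 1) ^ p := by
        gcongr
        norm_num
      _ = 4 * ((n : ℝ) + 1) ^ p := by norm_num
  have hx : ‖x‖ ≤ 2 * ‖x * a ^ n‖ := by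
    rw [norm_mul, norm_pow]
    nlinarith [norm_nonneg x]
  calc ν * ‖x‖ * δ ^ (-p) ≤ ν * (2 * ‖x * a ^ n‖) * (4 * ((n : ℝ) + 1) ^ p) := by gcongr
    _ = 8 * (((n : ℝ) + 1) ^ p * (ν * ‖x * a ^ n‖)) := by ring
    _ ≤ 8 * L := by linarith [h n hNn]

theorem norm_deriv_sub_dilation_le {α : ℝ} (hα0 : 0 < α) (hα1 : α < 1) {f : ℂ → ℂ}
    (hf : MemBloch α f) (hf1 : blochNorm α f ≤ 1) {r : ℝ} (hr0 : 0 ≤ r) (hr1 : r ≤ 1) {z : ℂ}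
    (hz : z ∈ unitDisk) :
    ‖deriv (fun z => f z - f ((r : ℂ) * z)) z‖ ≤ 2 * (1 - ‖z‖) ^ (-α) ∧
    ‖deriv (deriv fun z => f z - f ((r : ℂ) * z)) z‖ ≤ 8 * (1 - ‖z‖) ^ (-(α + 1)) := by
  have hfr := hf.dilation hα0 hr0 hr1
  have hfr1 := (blochNorm_dilation_le hα0 hf hr0 hr1).trans hf1
  have e : (fun z => f z - f ((r : ℂ) * z)) = fun z => 1 * f z + (-1) * f ((r : ℂ) * z) := by
    funext z
    ring
  rw [e, deriv_lincomb hf.1 hfr.1 1 (-1) hz, deriv_deriv_lincomb hf.1 hfr.1 1 (-1) hz]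
  constructor
  · refine (norm_add_le _ _).trans ?_
    rw [norm_mul, norm_mul, norm_neg, norm_one]
    linarith [norm_deriv_le_of_blochNorm_le_one hα0 hf hf1 hz,
      norm_deriv_le_of_blochNorm_le_one hα0 hfr hfr1 hz]
  · refine (norm_add_le _ _).trans ?_
    rw [norm_mul, norm_mul, norm_neg, norm_one]
    linarith [norm_deriv_deriv_le_of_blochNorm_le_one hα0 hα1 hf hf1 hz,
      norm_deriv_deriv_le_of_blochNorm_le_one hα0 hα1 hfr hfr1 hz]

theorem weight_mul_coeff_le {α β : ℝ} (hα0 : 0 < α) (hα1 : α < 1)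
    {u φ : ℂ → ℂ} (hu : DifferentiableOn ℂ u unitDisk) (hφ : DifferentiableOn ℂ φ unitDisk)
    (hm : MapsTo φ unitDisk unitDisk) (hb : BoundedBlochToZygmund α β u φ) {B : ℝ} (hB0 : 0 ≤ B)
    (hB : ∀ z ∈ unitDisk, (1 - ‖z‖ ^ 2) ^ β * ‖deriv (deriv u) z‖ ≤ B) {D : ℝ}
    (hD : ∀ n, zygNorm β (wcomp u φ (scaledMonomial α n)) ≤ D) {z : ℂ} (hz : z ∈ unitDisk) :
    (1 - ‖z‖ ^ 2) ^ β * ‖2 * deriv u z * deriv φ z + u z * deriv (deriv φ) z‖ ≤ 2 * D + B ∧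
    (1 - ‖z‖ ^ 2) ^ β * ‖u z * deriv φ z ^ 2‖ ≤ 2 * (2 * D + B) := by
  have h0 := rpow_mul_weight_scaledMonomial_le hα0 hα1 hu hφ hm hb hB (D := fun _ => D) hD hz 0
  have h1 := rpow_mul_weight_scaledMonomial_le hα0 hα1 hu hφ hm hb hB (D := fun _ => D) hD hz 1
  set x := 2 * deriv u z * deriv φ z + u z * deriv (deriv φ) z
  set y := u z * deriv φ z ^ 2
  have hν := (weight_pos β hz).le
  simp only [Nat.cast_zero, zero_add, Real.one_rpow, one_mul, pow_zero, mul_one, zero_mul,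
    add_zero, Nat.cast_one, pow_one, Nat.sub_self] at h0 h1
  refine ⟨h0, ?_⟩
  have h2 : (1 : ℝ) ≤ (1 + 1) ^ α := Real.one_le_rpow (by norm_num) hα0.le
  have h3 : ((1 : ℝ) + 1) ^ (α - 1) ≤ 1 :=
    Real.rpow_le_one_of_one_le_of_nonpos (by norm_num) (by linarith)
  have h4 : (1 - ‖z‖ ^ 2) ^ β * ‖x * φ z + y‖ ≤ 2 * D + B := by
    have : 0 ≤ (1 - ‖z‖ ^ 2) ^ β * ‖x * φ z + y‖ := mul_nonneg hν (norm_nonneg _)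
    nlinarith
  have h5 : ‖y‖ ≤ ‖x * φ z + y‖ + ‖x‖ := by
    have h6 : ‖y‖ ≤ ‖x * φ z + y‖ + ‖x * φ z‖ := by
      simpa using norm_sub_le (x * φ z + y) (x * φ z)
    have h7 : ‖x * φ z‖ ≤ ‖x‖ := by
      rw [norm_mul]
      exact mul_le_of_le_one_right (norm_nonneg _) (mem_unitDisk.mp (hm hz)).le
    linarith
  have h8 := mul_le_mul_of_nonneg_left h5 hν
  linarith

theorem essNormZ_le_of_eventually_le {α β : ℝ} (hα0 : 0 < α) (hα1 : α < 1)
    {u φ : ℂ → ℂ} (hu : DifferentiableOn ℂ u unitDisk) (hφ : DifferentiableOn ℂ φ unitDisk)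
    (hm : MapsTo φ unitDisk unitDisk) (hb : BoundedBlochToZygmund α β u φ) {L : ℝ}
    (hL1 : ∀ᶠ n : ℕ in atTop, ((n : ℝ) + 1) ^ α * wnorm β (fun z =>
      (2 * deriv u z * deriv φ z + u z * deriv (deriv φ) z) * φ z ^ n) ≤ L)
    (hL2 : ∀ᶠ n : ℕ in atTop, ((n : ℝ) + 1) ^ (α + 1) *
      wnorm β (fun z => u z * deriv φ z ^ 2 * φ z ^ n) ≤ L) {ε : ℝ} (hε : 0 < ε) :
    essNormZ α β (MemBloch α) u φ ≤ 80 * L + ε := by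
  obtain ⟨B, hB0, hB⟩ := hb.exists_weight_mul_deriv_deriv_le
  obtain ⟨D, hD0, hbd⟩ := hb.2
  have hD : ∀ n, zygNorm β (wcomp u φ (scaledMonomial α n)) ≤ D := fun n =>
    (hbd _ (memBloch_scaledMonomial hα0 hα1 n)).trans
      (mul_le_of_le_one_right hD0.le (blochNorm_scaledMonomial_le hα0 hα1 n))
  have hcoef := fun z hz => weight_mul_coeff_le hα0 hα1 hu hφ hm hb hB0 hB hD (z := z) hz
  set d := 2 * D + B with hd
  have hd0 : 0 ≤ d := by positivity
  obtain ⟨N, hN⟩ := eventually_atTop.mp (hL1.and hL2)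
  have hL0 : 0 ≤ L :=
    (mul_nonneg (by positivity) (wnorm_nonneg _ _)).trans (hN N le_rfl).1
  have hpow : ∀ z ∈ unitDisk, ∀ n : ℕ, ‖φ z ^ n‖ ≤ 1 := fun z hz n => by
    rw [norm_pow]
    exact pow_le_one₀ (norm_nonneg _) (mem_unitDisk.mp (hm hz)).le
  have hbound : ∀ {w : ℂ → ℂ} {c : ℝ}, (∀ z ∈ unitDisk, (1 - ‖z‖ ^ 2) ^ β * ‖w z‖ ≤ c) →
      ∀ n : ℕ, ∀ z ∈ unitDisk,
        (1 - ‖z‖ ^ 2) ^ β * ‖w z * φ z ^ n‖ ≤ wnorm β (fun z => w z * φ z ^ n) := by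
    intro w c hw n z hz
    refine le_wnorm (g := fun z => w z * φ z ^ n)
      (bddAbove_weighted (c := c) fun ζ hζ => ?_) hz
    refine le_trans ?_ (hw ζ hζ)
    rw [norm_mul]
    exact mul_le_mul_of_nonneg_left (mul_le_of_le_one_right (norm_nonneg _) (hpow ζ hζ n))
      (weight_pos β hζ).le
  set s := max (1 - 1 / (2 * ((N : ℝ) + 1))) ‖φ 0‖ with hs
  have hφ0 := mem_unitDisk.mp (hm zero_mem_unitDisk)
  have hs1 : s < 1 := max_lt (by have : 0 < 1 / (2 * ((N : ℝ) + 1)) := by positivity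
                                 linarith) hφ0
  set R := (1 - s) / 3 with hR
  have hR0 : 0 < R := by linarith
  set A := ‖u 0‖ + ‖deriv u 0‖ + ‖u 0‖ * ‖deriv φ 0‖ / R + B + d / R + 2 * d / R ^ 2 with hA
  have hA0 : 0 ≤ A := by positivity
  have hα : 0 < 1 - α := by linarith
  obtain ⟨r, hr0, hr1, hr⟩ : ∃ r : ℝ, 0 ≤ r ∧ r < 1 ∧
      A * ((1 - r) ^ (1 - α) / (1 - α)) ≤ ε := by
    have hc : ContinuousAt (fun r : ℝ => A * ((1 - r) ^ (1 - α) / (1 - α))) 1 := by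
      have : ContinuousAt (fun r : ℝ => (1 - r) ^ (1 - α)) 1 :=
        ContinuousAt.rpow_const (by fun_prop) (Or.inr hα.le)
      fun_prop
    have ht := hc.tendsto
    simp only [sub_self, Real.zero_rpow hα.ne', zero_div, mul_zero] at ht
    have h1 := (ht.eventually (ge_mem_nhds hε)).filter_mono
      (nhdsWithin_le_nhds (s := Iio (1 : ℝ)))
    have h2 : ∀ᶠ r : ℝ in nhdsWithin 1 (Iio 1), r ∈ Ioo 0 1 :=
      Ioo_mem_nhdsLT one_pos
    obtain ⟨r, h3, h4⟩ := (h1.and h2).exists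
    exact ⟨r, h4.1.le, h4.2, h3⟩
  set η := (1 - r) ^ (1 - α) / (1 - α) with hη
  have hη0 : 0 ≤ η := div_nonneg (Real.rpow_nonneg (by linarith) _) hα.le
  have hess : essNormZ α β (MemBloch α) u φ ≤ sSup {s | ∃ f, MemBloch α f ∧
      blochNorm α f ≤ 1 ∧ s = zygNorm β (fun z => wcomp u φ f z -
        wcomp u φ (fun z => f ((r : ℂ) * z)) z)} := by
    refine csInf_le ⟨0, ?_⟩ ⟨_, isCompactOpToZygmund_dilation hα0 hα1 hb hr0 hr1, rfl⟩
    rintro _ ⟨K, -, rfl⟩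
    refine Real.sSup_nonneg ?_
    rintro _ ⟨f, -, -, rfl⟩
    exact zygNorm_nonneg _ _
  refine hess.trans (Real.sSup_le ?_ (by positivity))
  rintro _ ⟨f, hf, hf1, rfl⟩
  rw [wcomp_sub]
  have hfr := hf.dilation hα0 hr0 hr1.le
  have hder := fun z hz =>
    norm_deriv_sub_dilation_le hα0 hα1 hf hf1 hr0 hr1.le (z := z) hz
  have hsup : ∀ z ∈ unitDisk, ‖f z - f ((r : ℂ) * z)‖ ≤ η := fun z hz =>
    norm_sub_dilation_le hα0 hα1 hf hf1 hr0 hr1.le hz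
  have hh := (hf.sub hfr).1
  set h : ℂ → ℂ := fun z => f z - f ((r : ℂ) * z) with hh_def
  have hd1' : ∀ z : ℂ, ‖z‖ ≤ s + R → ‖deriv h z‖ ≤ η / R := fun z hz =>
    norm_deriv_le_div_of_norm_le hh hR0 (by linarith) fun w hw =>
      hsup w (mem_unitDisk.mpr (by linarith))
  have hd1 : ∀ z : ℂ, ‖z‖ ≤ s → ‖deriv h z‖ ≤ η / R := fun z hz => hd1' z (by linarith)
  have hd2 : ∀ z : ℂ, ‖z‖ ≤ s → ‖deriv (deriv h) z‖ ≤ η / R / R := fun z hz =>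
    norm_deriv_le_div_of_norm_le (differentiableOn_deriv hh) hR0 (by linarith) fun w hw =>
      hd1' w (by linarith)
  have hz0 : ‖wcomp u φ h 0‖ ≤ ‖u 0‖ * η := by
    rw [wcomp, norm_mul]
    exact mul_le_mul_of_nonneg_left (hsup _ (hm zero_mem_unitDisk)) (norm_nonneg _)
  have hz1 : ‖deriv (wcomp u φ h) 0‖ ≤ ‖deriv u 0‖ * η + ‖u 0‖ * (η / R * ‖deriv φ 0‖) := by
    rw [deriv_wcomp hu hφ hm hh zero_mem_unitDisk]
    refine (norm_add_le _ _).trans ?_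
    rw [norm_mul, norm_mul, norm_mul]
    gcongr
    · exact hsup _ (hm zero_mem_unitDisk)
    · exact hd1 _ (le_max_right _ _)
  have hz2 : wnorm β (deriv (deriv (wcomp u φ h))) ≤
      B * η + d * (η / R) + 2 * d * (η / R / R) + 80 * L := by
    refine wnorm_le (by positivity) fun z hz => ?_
    have hν := (weight_pos β hz).le
    rw [deriv_deriv_wcomp hu hφ hm hh hz]
    obtain ⟨hx, hy⟩ := hcoef z hz
    have hxn := hbound (fun z hz => (hcoef z hz).1)
    have hyn := hbound (fun z hz => (hcoef z hz).2)
    have hxN : ∀ n, N ≤ n → ((n : ℝ) + 1) ^ α * ((1 - ‖z‖ ^ 2) ^ β *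
        ‖(2 * deriv u z * deriv φ z + u z * deriv (deriv φ) z) * φ z ^ n‖) ≤ L := fun n hn =>
      (mul_le_mul_of_nonneg_left (hxn n z hz) (by positivity)).trans (hN n hn).1
    have hyN : ∀ n, N ≤ n → ((n : ℝ) + 1) ^ (α + 1) * ((1 - ‖z‖ ^ 2) ^ β *
        ‖u z * deriv φ z ^ 2 * φ z ^ n‖) ≤ L := fun n hn =>
      (mul_le_mul_of_nonneg_left (hyn n z hz) (by positivity)).trans (hN n hn).2
    set x := 2 * deriv u z * deriv φ z + u z * deriv (deriv φ) z
    set y := u z * deriv φ z ^ 2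
    set ν := (1 - ‖z‖ ^ 2) ^ β
    have htri : ν * ‖deriv (deriv u) z * h (φ z) + x * deriv h (φ z) +
        y * deriv (deriv h) (φ z)‖ ≤ ν * ‖deriv (deriv u) z‖ * ‖h (φ z)‖ +
        ν * ‖x‖ * ‖deriv h (φ z)‖ + ν * ‖y‖ * ‖deriv (deriv h) (φ z)‖ := by
      calc _ ≤ ν * (‖deriv (deriv u) z * h (φ z)‖ + ‖x * deriv h (φ z)‖ +
              ‖y * deriv (deriv h) (φ z)‖) := mul_le_mul_of_nonneg_left norm_add₃_le hν
        _ = _ := by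
          rw [norm_mul, norm_mul x, norm_mul y]
          ring
    refine htri.trans ?_
    have hT0 : ν * ‖deriv (deriv u) z‖ * ‖h (φ z)‖ ≤ B * η :=
      mul_le_mul (hB z hz) (hsup _ (hm hz)) (norm_nonneg _) hB0
    rcases le_or_gt ‖φ z‖ s with hc | hc
    · have hT1 : ν * ‖x‖ * ‖deriv h (φ z)‖ ≤ d * (η / R) :=
        mul_le_mul hx (hd1 _ hc) (norm_nonneg _) hd0
      have hT2 : ν * ‖y‖ * ‖deriv (deriv h) (φ z)‖ ≤ 2 * d * (η / R / R) :=
        mul_le_mul hy (hd2 _ hc) (norm_nonneg _) (by positivity)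
      linarith
    · have hφz := mem_unitDisk.mp (hm hz)
      have hcN : 1 - ‖φ z‖ ≤ 1 / (2 * ((N : ℝ) + 1)) := by
        have := (le_max_left (1 - 1 / (2 * ((N : ℝ) + 1))) ‖φ 0‖).trans hc.le
        linarith
      have hT1 : ν * ‖x‖ * ‖deriv h (φ z)‖ ≤ 16 * L := by
        have h1 := mul_rpow_neg_le_of_pow_bound hα0.le (by linarith) hν hφz hcN hxN
        have h2 := mul_le_mul_of_nonneg_left (hder _ (hm hz)).1
          (mul_nonneg hν (norm_nonneg x))
        linarith
      have hT2 : ν * ‖y‖ * ‖deriv (deriv h) (φ z)‖ ≤ 64 * L := by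
        have h1 := mul_rpow_neg_le_of_pow_bound (by linarith : 0 ≤ α + 1) (by linarith) hν hφz
          hcN hyN
        have h2 := mul_le_mul_of_nonneg_left (hder _ (hm hz)).2
          (mul_nonneg hν (norm_nonneg y))
        linarith
      have h3 : 0 ≤ d * (η / R) := by positivity
      have h4 : 0 ≤ 2 * d * (η / R / R) := by positivity
      linarith
  have hsum : ‖u 0‖ * η + (‖deriv u 0‖ * η + ‖u 0‖ * (η / R * ‖deriv φ 0‖)) +
      (B * η + d * (η / R) + 2 * d * (η / R / R)) = A * η := by
    rw [hA]
    field_simp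
    ring
  unfold zygNorm
  linarith

theorem essNormZ_le_max_limsup {α β : ℝ} (hα0 : 0 < α) (hα1 : α < 1)
    {u φ : ℂ → ℂ} (hu : DifferentiableOn ℂ u unitDisk) (hφ : DifferentiableOn ℂ φ unitDisk)
    (hm : MapsTo φ unitDisk unitDisk) (hb : BoundedBlochToZygmund α β u φ) :
    essNormZ α β (MemBloch α) u φ ≤ 80 *
      max (limsup (fun n : ℕ => ((n : ℝ) + 1) ^ α * wnorm β (fun z =>
          (2 * deriv u z * deriv φ z + u z * deriv (deriv φ) z) * φ z ^ n)) atTop)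
        (limsup (fun n : ℕ => ((n : ℝ) + 1) ^ (α + 1) * wnorm β (fun z =>
          u z * deriv φ z ^ 2 * φ z ^ n)) atTop) := by
  obtain ⟨B, hB0, hB⟩ := hb.exists_weight_mul_deriv_deriv_le
  obtain ⟨D, hD0, hbd⟩ := hb.2
  have hD : ∀ n, zygNorm β (wcomp u φ (scaledMonomial α n)) ≤ D := fun n =>
    (hbd _ (memBloch_scaledMonomial hα0 hα1 n)).trans
      (mul_le_of_le_one_right hD0.le (blochNorm_scaledMonomial_le hα0 hα1 n))
  have hle : ∀ k : ℕ, 2 * D + B * ((k : ℝ) + 1) ^ (α - 1) ≤ 2 * D + B := fun k => by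
    have : ((k : ℝ) + 1) ^ (α - 1) ≤ 1 :=
      Real.rpow_le_one_of_one_le_of_nonpos (by linarith [(Nat.cast_nonneg k : (0 : ℝ) ≤ k)])
        (by linarith)
    linarith [mul_le_of_le_one_right hB0 this]
  have hw := fun n : ℕ => rpow_mul_wnorm_le hα0 hα1 hu hφ hm hb hB0 hB (D := fun _ => D) hD
    (n := n) (hle _) (hle _)
  have hbdd1 : IsBoundedUnder (· ≤ ·) atTop (fun n : ℕ => ((n : ℝ) + 1) ^ α * wnorm β (fun z =>
      (2 * deriv u z * deriv φ z + u z * deriv (deriv φ) z) * φ z ^ n)) :=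
    isBoundedUnder_of_eventually_le (Eventually.of_forall fun n => (hw n).1)
  have hbdd2 : IsBoundedUnder (· ≤ ·) atTop (fun n : ℕ => ((n : ℝ) + 1) ^ (α + 1) *
      wnorm β (fun z => u z * deriv φ z ^ 2 * φ z ^ n)) :=
    isBoundedUnder_of_eventually_le ((eventually_ge_atTop 2).mono fun n hn => (hw n).2 hn)
  refine le_of_forall_pos_le_add fun ε hε => ?_
  set M := max (limsup (fun n : ℕ => ((n : ℝ) + 1) ^ α * wnorm β (fun z =>
          (2 * deriv u z * deriv φ z + u z * deriv (deriv φ) z) * φ z ^ n)) atTop)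
        (limsup (fun n : ℕ => ((n : ℝ) + 1) ^ (α + 1) * wnorm β (fun z =>
          u z * deriv φ z ^ 2 * φ z ^ n)) atTop) with hM
  have hε' : 0 < ε / 160 := by positivity
  have h1 := eventually_lt_of_limsup_lt (b := M + ε / 160)
    ((le_max_left _ _).trans_lt (lt_add_of_pos_right M hε')) hbdd1
  have h2 := eventually_lt_of_limsup_lt (b := M + ε / 160)
    ((le_max_right _ _).trans_lt (lt_add_of_pos_right M hε')) hbdd2
  have := essNormZ_le_of_eventually_le hα0 hα1 hu hφ hm hb (h1.mono fun _ h => h.le)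
    (h2.mono fun _ h => h.le) (half_pos hε)
  linarith

theorem max_limsup_le_essNormZ {α β : ℝ} (hα0 : 0 < α) (hα1 : α < 1)
    {u φ : ℂ → ℂ} (hu : DifferentiableOn ℂ u unitDisk) (hφ : DifferentiableOn ℂ φ unitDisk)
    (hm : MapsTo φ unitDisk unitDisk) (hb : BoundedBlochToZygmund α β u φ) :
    1 / 32 * max (limsup (fun n : ℕ => ((n : ℝ) + 1) ^ α * wnorm β (fun z =>
          (2 * deriv u z * deriv φ z + u z * deriv (deriv φ) z) * φ z ^ n)) atTop)
        (limsup (fun n : ℕ => ((n : ℝ) + 1) ^ (α + 1) * wnorm β (fun z =>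
          u z * deriv φ z ^ 2 * φ z ^ n)) atTop) ≤
      essNormZ α β (MemBloch α) u φ := by
  refine le_csInf ⟨_, _, isCompactOpToZygmund_dilation hα0 hα1 hb le_rfl zero_lt_one, rfl⟩ ?_
  rintro _ ⟨K, hK, rfl⟩
  have := limsup_le_sSup_of_isCompactOp hα0 hα1 hu hφ hm hb hK
  linarith

/-- **Theorem 4.3** (sequential form). For `0 < α < 1` and `uC_φ : B^α → Z_β` bounded,
`‖uC_φ‖_e ≍ max {limsup_n (n+1)^α ‖(2u'φ'+uφ'')φ^n‖_ν_β,
limsup_n (n+1)^(α+1) ‖u(φ')²φ^n‖_ν_β}`, with constants depending only on `α, β`. -/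
theorem essNorm_Bloch_to_Zygmund_of_lt_one
    (α β : ℝ) (hα0 : 0 < α) (hα1 : α < 1) (hβ : 0 < β) :
    ∃ c C : ℝ, 0 < c ∧ 0 < C ∧
      ∀ u φ : ℂ → ℂ, DifferentiableOn ℂ u unitDisk → DifferentiableOn ℂ φ unitDisk →
        Set.MapsTo φ unitDisk unitDisk → BoundedBlochToZygmund α β u φ →
        c * max
              (Filter.limsup
                (fun n : ℕ => ((n : ℝ) + 1) ^ α * wnorm β (fun z => (2 * deriv u z * deriv φ z + u z * deriv (deriv φ) z) * φ z ^ n)) Filter.atTop)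
              (Filter.limsup
                (fun n : ℕ => ((n : ℝ) + 1) ^ (α + 1) * wnorm β (fun z => u z * deriv φ z ^ 2 * φ z ^ n)) Filter.atTop)
            ≤ essNormZ α β (MemBloch α) u φ ∧
          essNormZ α β (MemBloch α) u φ
            ≤ C * max
                (Filter.limsup
                  (fun n : ℕ => ((n : ℝ) + 1) ^ α * wnorm β (fun z => (2 * deriv u z * deriv φ z + u z * deriv (deriv φ) z) * φ z ^ n)) Filter.atTop)
                (Filter.limsup
                  (fun n : ℕ => ((n : ℝ) + 1) ^ (α + 1) * wnorm β (fun z => u z * deriv φ z ^ 2 * φ z ^ n)) Filter.atTop) := by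
  exact ⟨1 / 32, 80, by norm_num, by norm_num, fun u φ hu hφ hm hb =>
    ⟨max_limsup_le_essNormZ hα0 hα1 hu hφ hm hb, essNormZ_le_max_limsup hα0 hα1 hu hφ hm hb⟩⟩

end
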